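/- arXiv:2407.20620 — 3 statements merged into one kernel-verified Lean document; each statement's English description precedes it below -/
import Mathlib

section
/- Let f(x) = (1/2)⟨x, Qx⟩ + ⟨q, x⟩ with Q symmetric positive semidefinite with largest eigenvalue L > 0, let g : ℝⁿ → ℝ be convex and lower semicontinuous, and let μ ∈ (0, 1/L) and α > 0. Set γ(t) = 3/(t+3) and β(t) = 1 − γ(t). Then there exists a constant c₁ > 0, depending only on Q, q, g, μ, α, such that for every twice continuously differentiable x : [0,∞) → ℝⁿ satisfying ẍ(t) + γ(t)ẋ(t) + α G_μ(x(t) + β(t)ẋ(t)) = 0 for all t ≥ 0, every minimizer x⋆ of F = f + g, and every t ≥ 0: F(p_μ(x(t))) − F(x⋆) ≤ c₁ (‖x(0) − x⋆‖² + ‖ẋ(0)‖²)/(t+3)². -/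
open Set RealInnerProductSpace

noncomputable section

section Aux

variable {E : Type*} [NormedAddCommGroup E] [InnerProductSpace ℝ E] [CompleteSpace E]

lemma aux_hasGradientAt (h : E → ℝ) (w x : E) (C : ℝ)
    (hb : ∀ z, |h z - h x - ⟪w, z - x⟫| ≤ C * ‖z - x‖ ^ 2) : HasGradientAt h w x := by
  rw [hasGradientAt_iff_isLittleO]
  have h1 : (fun z => h z - h x - ⟪w, z - x⟫) =O[nhds x] fun z => ‖z - x‖ ^ 2 := by
    apply Asymptotics.IsBigO.of_bound C
    filter_upwards with z
    simpa using hb z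
  refine h1.trans_isLittleO ?_
  have h2 : (fun z => ‖z - x‖ ^ 2) = fun z => ‖z - x‖ * ‖z - x‖ := by
    funext z; ring
  rw [h2]
  have h3 : (fun z => ‖z - x‖) =o[nhds x] (fun _ => (1 : ℝ)) := by
    rw [Asymptotics.isLittleO_one_iff]
    have : ContinuousAt (fun z => ‖z - x‖) x := by fun_prop
    simpa [ContinuousAt] using this
  have h4 := h3.mul_isBigO (Asymptotics.isBigO_refl (fun z => ‖z - x‖) (nhds x))
  simp only [one_mul] at h4
  exact h4.trans_isBigO (Asymptotics.isBigO_norm_left.2 (Asymptotics.isBigO_refl _ _))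

lemma aux_prox (g : E → ℝ) (hg : ConvexOn ℝ univ g) (μ : ℝ) (hμ : 0 < μ) (v p : E)
    (hp : IsMinOn (fun z => g z + ‖z - v‖ ^ 2 / (2 * μ)) univ p) (z : E) :
    g p + ⟪v - p, z - p⟫ / μ ≤ g z := by
  by_contra! hlt
  set D := g p + ⟪v - p, z - p⟫ / μ - g z with hD
  have hDpos : 0 < D := by linarith
  set K := ‖z - p‖ ^ 2 / (2 * μ) with hK
  have hK0 : 0 ≤ K := by positivity
  have key : ∀ s : ℝ, 0 < s → s ≤ 1 → D ≤ s * K := by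
    intro s hs hs1
    have h1 := isMinOn_univ_iff.1 hp ((1 - s) • p + s • z)
    have h2 := hg.2 (mem_univ p) (mem_univ z) (by linarith : 0 ≤ 1 - s) hs.le (by ring)
    have h3 : (1 - s) • p + s • z - v = (p - v) + s • (z - p) := by module
    simp only [smul_eq_mul] at h1 h2
    rw [h3, norm_add_sq_real, norm_smul, inner_smul_right, mul_pow, Real.norm_eq_abs, sq_abs] at h1
    have h4 : ⟪p - v, z - p⟫ = - ⟪v - p, z - p⟫ := by
      rw [← inner_neg_left, neg_sub]
    rw [h4] at h1
    have h5 : (‖p - v‖ ^ 2 + 2 * (s * -⟪v - p, z - p⟫) + s ^ 2 * ‖z - p‖ ^ 2) / (2 * μ)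
        = ‖p - v‖ ^ 2 / (2 * μ) - s * (⟪v - p, z - p⟫ / μ) + s ^ 2 * K := by
      rw [hK]; field_simp; ring
    rw [h5] at h1
    have h6 : 0 ≤ s * (s * K - D) := by rw [hD]; nlinarith
    have := nonneg_of_mul_nonneg_right h6 hs
    linarith
  have h1 := key (min 1 (D / (2 * (K + 1)))) (by positivity) (min_le_left _ _)
  have h2 : min 1 (D / (2 * (K + 1))) * K ≤ D / (2 * (K + 1)) * K :=
    mul_le_mul_of_nonneg_right (min_le_right _ _) hK0
  have h3 : D / (2 * (K + 1)) * K ≤ D / 2 := by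
    rw [div_mul_eq_mul_div, div_le_div_iff₀ (by positivity) (by positivity)]
    nlinarith
  linarith

lemma aux_quad (Q : E →L[ℝ] E) (q : E) (hQsym : ∀ x y : E, ⟪Q x, y⟫ = ⟪x, Q y⟫)
    (f : E → ℝ) (hf : ∀ x, f x = (1 / 2) * ⟪x, Q x⟫ + ⟪q, x⟫) (x z : E) :
    f z = f x + ⟪Q x + q, z - x⟫ + (1 / 2) * ⟪z - x, Q (z - x)⟫ := by
  have e : ⟪z, Q x⟫ = ⟪x, Q z⟫ := by rw [← hQsym z x, real_inner_comm]
  have e1 : ⟪Q x, z⟫ = ⟪x, Q z⟫ := hQsym x z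
  have e2 : ⟪Q x, x⟫ = ⟪x, Q x⟫ := hQsym x x
  simp only [hf, map_sub, inner_add_left, inner_sub_left, inner_sub_right, e, e1, e2]
  ring

/-- The accelerated flow for an abstract Moreau envelope `h` in the metric `W`. -/
lemma aux_flow (W : E →L[ℝ] E) (hWsym : ∀ x y : E, ⟪W x, y⟫ = ⟪x, W y⟫)
    (hW0 : ∀ x : E, 0 ≤ ⟪x, W x⟫) (h : E → ℝ) (G : E → E) (Fs α : ℝ) (hα : 0 < α) (xs : E)
    (hgrad : ∀ x, HasGradientAt h (W (G x)) x)
    (hsub : ∀ x z, h x + ⟪W (G x), z - x⟫ ≤ h z)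
    (hFs : h xs ≤ Fs) (x v a : ℝ → E)
    (hx : ∀ t ∈ Ici (0 : ℝ), HasDerivWithinAt x (v t) (Ici 0) t)
    (hv : ∀ t ∈ Ici (0 : ℝ), HasDerivWithinAt v (a t) (Ici 0) t)
    (hode : ∀ t ∈ Ici (0 : ℝ),
      a t + (3 / (t + 3)) • v t + α • G (x t + (1 - 3 / (t + 3)) • v t) = 0)
    (t : ℝ) (ht : 0 ≤ t) :
    α * (t + 3) ^ 2 * (h (x t) - Fs) ≤ 9 * α * (h (x 0) - Fs) +
      2 * ⟪x 0 - xs + (3 / 2 : ℝ) • v 0, W (x 0 - xs + (3 / 2 : ℝ) • v 0)⟫ := by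
  set r : ℝ → E := fun t => x t - xs + ((t + 3) / 2) • v t with hr
  set V : ℝ → ℝ := fun t => α * (t + 3) ^ 2 * (h (x t) - Fs) + 2 * ⟪r t, W (r t)⟫ with hV
  set y : ℝ → E := fun t => x t + (1 - 3 / (t + 3)) • v t with hy
  have hrd : ∀ t ∈ Ici (0 : ℝ),
      HasDerivWithinAt r (-((α * (t + 3) / 2) • G (y t))) (Ici 0) t := by
    intro t ht
    have ht0 : (0 : ℝ) ≤ t := ht
    have h1 : HasDerivWithinAt (fun t : ℝ => (t + 3) / 2) (1 / 2) (Ici 0) t :=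
      (((hasDerivAt_id t).add_const 3).div_const 2).hasDerivWithinAt
    have h2 := ((hx t ht).sub_const xs).add (h1.smul (hv t ht))
    have h3 : a t = -((3 / (t + 3)) • v t) - α • G (y t) := by
      have := hode t ht
      rw [eq_sub_iff_add_eq, eq_neg_iff_add_eq_zero, ← this]
      simp only [hy]; abel
    refine h2.congr_deriv ?_
    rw [h3]
    match_scalars <;> field_simp <;> ring
  have hVd : ∀ t ∈ Ici (0 : ℝ), HasDerivWithinAt V
      (2 * α * (t + 3) * (h (x t) - Fs) + α * (t + 3) ^ 2 * ⟪W (G (x t)), v t⟫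
        - 2 * α * (t + 3) * ⟪W (G (y t)), r t⟫) (Ici 0) t := by
    intro t ht
    have h1 : HasDerivWithinAt (fun t : ℝ => α * (t + 3) ^ 2) (α * (2 * (t + 3))) (Ici 0) t := by
      have := ((((hasDerivAt_id t).add_const 3).pow 2).const_mul α).hasDerivWithinAt (s := Ici 0)
      refine this.congr_deriv ?_
      simp
    have h2 : HasDerivWithinAt (fun t => h (x t)) ⟪W (G (x t)), v t⟫ (Ici 0) t := by
      have := (hgrad (x t)).hasFDerivAt.comp_hasDerivWithinAt t (hx t ht)
      refine this.congr_deriv ?_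
      simp
    have h3 : HasDerivWithinAt (fun t => W (r t)) (W (-((α * (t + 3) / 2) • G (y t)))) (Ici 0) t :=
      W.hasFDerivAt.comp_hasDerivWithinAt t (hrd t ht)
    have h4 := (hrd t ht).inner ℝ h3
    have h5 := (h1.mul (h2.sub_const Fs)).add (h4.const_mul 2)
    refine h5.congr_deriv ?_
    have e : ⟪G (y t), W (r t)⟫ = ⟪W (G (y t)), r t⟫ := (hWsym _ _).symm
    have ee : ⟪r t, W (G (y t))⟫ = ⟪W (G (y t)), r t⟫ := real_inner_comm _ _
    simp only [map_neg, map_smul, inner_neg_left, inner_neg_right, inner_smul_left,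
      inner_smul_right, e, ee, RCLike.conj_to_real]
    ring
  have hneg : ∀ t ∈ Ici (0 : ℝ), (2 * α * (t + 3) * (h (x t) - Fs)
      + α * (t + 3) ^ 2 * ⟪W (G (x t)), v t⟫ - 2 * α * (t + 3) * ⟪W (G (y t)), r t⟫) ≤ 0 := by
    intro t ht
    have ht0 : (0 : ℝ) ≤ t := ht
    set b : ℝ := 1 - 3 / (t + 3) with hb
    have hbt : b * (t + 3) = t := by rw [hb]; field_simp; ring
    have hb0 : 0 ≤ b := by
      rw [hb, sub_nonneg, div_le_one (by positivity)]; linarith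
    have hb1 : b ≤ 1 := by
      rw [hb]; have : 0 ≤ 3 / (t + 3) := by positivity
      linarith
    have s1 := hsub (y t) xs
    have s2 := hsub (x t) (y t)
    have s3 := hsub (y t) (x t)
    have e1 : xs - y t = -(x t - xs) - b • v t := by simp only [hy]; rw [← hb]; module
    have e2 : y t - x t = b • v t := by simp only [hy]; rw [← hb]; module
    have e3 : x t - y t = -(b • v t) := by rw [← e2]; abel
    rw [e1, inner_sub_right, inner_neg_right, inner_smul_right] at s1
    rw [e2, inner_smul_right] at s2
    rw [e3, inner_neg_right, inner_smul_right] at s3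
    have e4 : ⟪W (G (y t)), r t⟫ = ⟪W (G (y t)), x t - xs⟫ + (t + 3) / 2 * ⟪W (G (y t)), v t⟫ := by
      simp only [hr, inner_add_right, inner_smul_right]
    rw [e4]
    set P := ⟪W (G (y t)), v t⟫
    set R := ⟪W (G (x t)), v t⟫
    set S := ⟪W (G (y t)), x t - xs⟫
    have hM : 0 ≤ b * (P - R) := by linarith
    have hMM : h (x t) - Fs - S ≤ b * (P - R) := by linarith
    have hPR : 2 * b * (P - R) ≤ (t + 3) * (P - R) := by
      rcases eq_or_lt_of_le ht0 with h0 | h0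
      ·
        have hbz : b = 0 := by rw [hb, ← h0]; norm_num
        have : y t = x t := by
          have := e2
          rw [hbz, zero_smul] at this
          exact sub_eq_zero.1 this
        have hPR0 : P - R = 0 := by simp only [P, R, this, sub_self]
        rw [hPR0]; simp
      · have hbpos : 0 < b := by
          by_contra! hc
          have : b = 0 := le_antisymm hc hb0
          rw [this] at hbt; linarith
        have : 0 ≤ P - R := nonneg_of_mul_nonneg_right hM hbpos
        nlinarith
    have hat : 0 ≤ α * (t + 3) := by positivity
    have f1 : 0 ≤ α * (t + 3) * (b * (P - R) - (h (x t) - Fs - S)) :=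
      mul_nonneg hat (by linarith)
    have f2 : 0 ≤ α * (t + 3) * ((t + 3) * (P - R) - 2 * b * (P - R)) :=
      mul_nonneg hat (by linarith)
    nlinarith
  have hanti : AntitoneOn V (Ici 0) := by
    refine antitoneOn_of_hasDerivWithinAt_nonpos (convex_Ici 0)
      (fun t ht => (hVd t ht).continuousWithinAt)
      (fun t ht => (hVd t (interior_subset ht)).mono interior_subset)
      (fun t ht => hneg t (interior_subset ht))
  have hfin := hanti (mem_Ici.2 le_rfl) (mem_Ici.2 ht) ht
  have hrW := hW0 (r t)
  have hV0 : V 0 = 9 * α * (h (x 0) - Fs) +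
      2 * ⟪x 0 - xs + (3 / 2 : ℝ) • v 0, W (x 0 - xs + (3 / 2 : ℝ) • v 0)⟫ := by
    simp only [hV, hr, zero_add]; ring
  rw [← hV0]
  have hVt : V t = α * (t + 3) ^ 2 * (h (x t) - Fs) + 2 * ⟪r t, W (r t)⟫ := rfl
  linarith

end Aux

/-- Theorem 1, forward–backward case: accelerated sublinear
convergence of the accelerated forward–backward splitting dynamics for a convex
quadratic `f` plus a convex lower semicontinuous `g`. -/
theorem accelerated_FB_convex_quadratic {n : ℕ}
    (Q : EuclideanSpace ℝ (Fin n) →L[ℝ] EuclideanSpace ℝ (Fin n))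
    (q : EuclideanSpace ℝ (Fin n)) (g : EuclideanSpace ℝ (Fin n) → ℝ)
    (L μ α : ℝ)
    (hQsym : ∀ x y : EuclideanSpace ℝ (Fin n), ⟪Q x, y⟫ = ⟪x, Q y⟫)
    (hQpsd : ∀ x : EuclideanSpace ℝ (Fin n), 0 ≤ ⟪x, Q x⟫)
    (hL : 0 < L)
    (hQL : ∀ x : EuclideanSpace ℝ (Fin n), ⟪x, Q x⟫ ≤ L * ‖x‖ ^ 2)
    (hQLmax : ∃ x : EuclideanSpace ℝ (Fin n), x ≠ 0 ∧ ⟪x, Q x⟫ = L * ‖x‖ ^ 2)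
    (f F : EuclideanSpace ℝ (Fin n) → ℝ)
    (hf : ∀ x, f x = (1 / 2) * ⟪x, Q x⟫ + ⟪q, x⟫)
    (hF : ∀ x, F x = f x + g x)
    (hgconv : ConvexOn ℝ univ g) (hglsc : LowerSemicontinuous g)
    (hμ : μ ∈ Ioo 0 (1 / L)) (hα : 0 < α)
    (proxg : EuclideanSpace ℝ (Fin n) → EuclideanSpace ℝ (Fin n))
    (hproxg : ∀ v, IsMinOn (fun z => g z + ‖z - v‖ ^ 2 / (2 * μ)) univ (proxg v))
    (G p : EuclideanSpace ℝ (Fin n) → EuclideanSpace ℝ (Fin n))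
    (hG : ∀ x, G x = μ⁻¹ • (x - proxg (x - μ • gradient f x)))
    (hp : ∀ x, p x = proxg (x - μ • gradient f x))
    (γ β : ℝ → ℝ)
    (hγ : ∀ t, γ t = 3 / (t + 3)) (hβ : ∀ t, β t = 1 - γ t) :
    ∃ c > (0 : ℝ), ∀ x v a : ℝ → EuclideanSpace ℝ (Fin n),
      (∀ t ∈ Ici (0 : ℝ), HasDerivWithinAt x (v t) (Ici 0) t) →
      (∀ t ∈ Ici (0 : ℝ), HasDerivWithinAt v (a t) (Ici 0) t) →
      ContinuousOn a (Ici 0) →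
      (∀ t ∈ Ici (0 : ℝ), a t + γ t • v t + α • G (x t + β t • v t) = 0) →
      ∀ xs, IsMinOn F univ xs →
        ∀ t ∈ Ici (0 : ℝ),
          F (p (x t)) - F xs ≤ c * (‖x 0 - xs‖ ^ 2 + ‖v 0‖ ^ 2) / (t + 3) ^ 2 := by
  have hμ0 : 0 < μ := hμ.1
  have hμL : μ * L ≤ 1 := by
    have := hμ.2
    rw [lt_div_iff₀ hL] at this
    exact this.le
  have hquad := aux_quad Q q hQsym f hf
  have hgradf : ∀ x, gradient f x = Q x + q := by
    intro x
    refine (aux_hasGradientAt f (Q x + q) x L ?_).gradient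
    intro z
    have h1 := hquad x z
    have h2 := hQpsd (z - x)
    have h3 := hQL (z - x)
    rw [abs_le]
    constructor <;> nlinarith
  set W : EuclideanSpace ℝ (Fin n) →L[ℝ] EuclideanSpace ℝ (Fin n) :=
    ContinuousLinearMap.id ℝ _ - μ • Q with hW
  have hWx : ∀ x, W x = x - μ • Q x := fun x => by simp [hW]
  have hWsym : ∀ x y, ⟪W x, y⟫ = ⟪x, W y⟫ := by
    intro x y
    simp only [hWx, inner_sub_left, inner_sub_right, real_inner_smul_left, real_inner_smul_right,
      hQsym]
  have hWq : ∀ x, ⟪x, W x⟫ = ‖x‖ ^ 2 - μ * ⟪x, Q x⟫ := by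
    intro x
    rw [hWx, inner_sub_right, real_inner_smul_right, real_inner_self_eq_norm_sq]
  have hW0 : ∀ x, 0 ≤ ⟪x, W x⟫ := by
    intro x
    rw [hWq]
    have := mul_le_mul_of_nonneg_left (hQL x) hμ0.le
    nlinarith [sq_nonneg ‖x‖]
  have hW1 : ∀ x, ⟪x, W x⟫ ≤ ‖x‖ ^ 2 := by
    intro x
    rw [hWq]
    have := mul_nonneg hμ0.le (hQpsd x)
    linarith
  have hpG : ∀ x, p x = x - μ • G x := by
    intro x
    rw [hG, hp, smul_smul, mul_inv_cancel₀ hμ0.ne', one_smul]; abel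
  -- optimality of the forward-backward point
  have hopt : ∀ x z, F (p x) + ⟪W (G x), z - p x⟫ ≤ F z := by
    intro x z
    have h1 := aux_prox g hgconv μ hμ0 _ _ (hproxg (x - μ • gradient f x)) z
    rw [← hp, hgradf] at h1
    have h2 := hquad (p x) z
    have h3 := hQpsd (z - p x)
    have h4 : ⟪W (G x), z - p x⟫ = ⟪Q (p x) + q, z - p x⟫
        + ⟪x - μ • (Q x + q) - p x, z - p x⟫ / μ := by
      have e : W (G x) = (Q (p x) + q) + μ⁻¹ • (x - μ • (Q x + q) - p x) := by
        rw [hWx, hpG, map_sub, map_smul]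
        match_scalars <;> field_simp <;> ring
      rw [e, inner_add_left, real_inner_smul_left]; ring
    rw [hF, hF, h4]
    linarith
  set h : EuclideanSpace ℝ (Fin n) → ℝ := fun x => F (p x) + μ / 2 * ⟪G x, W (G x)⟫ with hh
  have hupF : ∀ x z, h x ≤ F z + 1 / (2 * μ) * ⟪x - z, W (x - z)⟫ := by
    intro x z
    have h1 := hopt x z
    have h2 := hW0 (p x - z)
    have e1 : x - z = (p x - z) + μ • G x := by rw [hpG]; abel
    have e2 : z - p x = -(p x - z) := by abel
    have e3 : ⟪p x - z, W (G x)⟫ = ⟪W (G x), p x - z⟫ := real_inner_comm _ _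
    have e4 : ⟪G x, W (p x - z)⟫ = ⟪W (G x), p x - z⟫ := (hWsym _ _).symm
    have e5 : 1 / (2 * μ) * ⟪x - z, W (x - z)⟫ = 1 / (2 * μ) * ⟪p x - z, W (p x - z)⟫
        + ⟪W (G x), p x - z⟫ + μ / 2 * ⟪G x, W (G x)⟫ := by
      rw [e1]
      simp only [map_add, map_smul, inner_add_left, inner_add_right, real_inner_smul_left,
        real_inner_smul_right, e3, e4]
      field_simp; ring
    rw [e5]
    rw [e2, inner_neg_right] at h1
    have : 0 ≤ 1 / (2 * μ) * ⟪p x - z, W (p x - z)⟫ := by positivity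
    simp only [hh]
    linarith
  have hsub : ∀ x z, h x + ⟪W (G x), z - x⟫ ≤ h z := by
    intro x z
    have h1 := hopt x (p z)
    have h2 := hW0 (G z - G x)
    have e1 : p z - p x = (z - x) - μ • (G z - G x) := by rw [hpG, hpG]; module
    have e2 : ⟪W (G x), G z⟫ = ⟪G x, W (G z)⟫ := hWsym _ _
    have e3 : ⟪G z, W (G x)⟫ = ⟪G x, W (G z)⟫ := by rw [real_inner_comm, hWsym]
    have e4 : ⟪W (G x), G x⟫ = ⟪G x, W (G x)⟫ := hWsym _ _
    rw [e1, inner_sub_right, real_inner_smul_right, inner_sub_right _ (G z), e2, e4] at h1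
    simp only [map_sub, inner_sub_left, inner_sub_right, e3] at h2
    simp only [hh]
    nlinarith [mul_nonneg hμ0.le h2]
  have hup : ∀ x z, h z ≤ h x + ⟪W (G x), z - x⟫ + 1 / (2 * μ) * ⟪z - x, W (z - x)⟫ := by
    intro x z
    have h1 := hupF z (p x)
    have e1 : z - p x = (z - x) + μ • G x := by rw [hpG]; abel
    have e3 : ⟪z - x, W (G x)⟫ = ⟪W (G x), z - x⟫ := real_inner_comm _ _
    have e4 : ⟪G x, W (z - x)⟫ = ⟪W (G x), z - x⟫ := (hWsym _ _).symm
    have e5 : 1 / (2 * μ) * ⟪z - p x, W (z - p x)⟫ = 1 / (2 * μ) * ⟪z - x, W (z - x)⟫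
        + ⟪W (G x), z - x⟫ + μ / 2 * ⟪G x, W (G x)⟫ := by
      rw [e1, map_add, map_smul, inner_add_left, inner_add_right, inner_add_right,
        real_inner_smul_left, real_inner_smul_left, real_inner_smul_right, real_inner_smul_right,
        e3, e4]
      field_simp; ring
    rw [e5] at h1
    have e6 : h x = F (p x) + μ / 2 * ⟪G x, W (G x)⟫ := rfl
    linarith
  have hgrad : ∀ x, HasGradientAt h (W (G x)) x := by
    intro x
    refine aux_hasGradientAt h _ x (1 / (2 * μ)) ?_
    intro z
    have h1 := hsub x z
    have h2 := hup x z
    have h3 : 1 / (2 * μ) * ⟪z - x, W (z - x)⟫ ≤ 1 / (2 * μ) * ‖z - x‖ ^ 2 :=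
      mul_le_mul_of_nonneg_left (hW1 _) (by positivity)
    rw [abs_of_nonneg (by linarith)]
    linarith
  refine ⟨9 / (2 * μ) + 9 / α, by positivity, ?_⟩
  intro x v a hx hv _ hode xs hxs t ht
  have ht0 : (0 : ℝ) ≤ t := ht
  have hFs : h xs ≤ F xs := by
    have := hupF xs xs
    simpa using this
  have key := aux_flow W hWsym hW0 h G (F xs) α hα xs hgrad hsub hFs x v a hx hv
    (fun t ht => by have := hode t ht; rwa [hβ, hγ] at this) t ht0
  have k1 := hupF (x 0) xs
  have k2 : 1 / (2 * μ) * ⟪x 0 - xs, W (x 0 - xs)⟫ ≤ 1 / (2 * μ) * ‖x 0 - xs‖ ^ 2 :=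
    mul_le_mul_of_nonneg_left (hW1 _) (by positivity)
  have k3 := hW1 (x 0 - xs + (3 / 2 : ℝ) • v 0)
  have k4 : ‖x 0 - xs + (3 / 2 : ℝ) • v 0‖ ^ 2 ≤ 2 * ‖x 0 - xs‖ ^ 2 + 9 / 2 * ‖v 0‖ ^ 2 := by
    have h1 : ‖x 0 - xs + (3 / 2 : ℝ) • v 0‖ ≤ ‖x 0 - xs‖ + 3 / 2 * ‖v 0‖ := by
      refine (norm_add_le _ _).trans ?_
      rw [norm_smul]; norm_num
    have h2 := pow_le_pow_left₀ (norm_nonneg _) h1 2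
    nlinarith [sq_nonneg (‖x 0 - xs‖ - 3 / 2 * ‖v 0‖)]
  have k5 : F (p (x t)) ≤ h (x t) := by
    have : 0 ≤ μ / 2 * ⟪G (x t), W (G (x t))⟫ := mul_nonneg (by positivity) (hW0 _)
    simp only [hh]; linarith
  rw [le_div_iff₀ (by positivity)]
  have hA := sq_nonneg ‖x 0 - xs‖
  have hB := sq_nonneg ‖v 0‖
  set A := ‖x 0 - xs‖ ^ 2
  set B := ‖v 0‖ ^ 2
  have m1 : α * (t + 3) ^ 2 * (F (p (x t)) - F xs) ≤ α * (t + 3) ^ 2 * (h (x t) - F xs) :=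
    mul_le_mul_of_nonneg_left (by linarith) (by positivity)
  have m2 : 9 * α * (h (x 0) - F xs) ≤ 9 * α * (1 / (2 * μ) * A) :=
    mul_le_mul_of_nonneg_left (by linarith) (by positivity)
  have m3 : α * ((F (p (x t)) - F xs) * (t + 3) ^ 2)
      ≤ α * ((9 / (2 * μ) + 9 / α) * (A + B)) := by
    have e : α * ((9 / (2 * μ) + 9 / α) * (A + B))
        = 9 * α * (1 / (2 * μ) * A) + 9 * α * (1 / (2 * μ) * B) + 9 * A + 9 * B := by
      field_simp; ring
    have : 0 ≤ 9 * α * (1 / (2 * μ) * B) := by positivity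
    rw [e]; linarith
  exact le_of_mul_le_mul_left m3 hα
end
end

section
/- Let f(x) = (1/2)⟨x, Qx⟩ + ⟨q, x⟩ with Q symmetric positive definite with smallest eigenvalue m > 0 and largest eigenvalue L, let g : ℝⁿ → ℝ be convex and lower semicontinuous, and let μ ∈ (0, 1/L). Set m̃ = min{(1 − μm)m, (1 − μL)L}, and let α > 0 with α m̃ < 1, γ = 2√(α m̃)/(√(α m̃) + 1), β = 1 − γ, ρ = √(α m̃) − α m̃ / 2. Then there exists c₂ > 0, depending only on Q, q, g, μ, α, such that for every twice continuously differentiable x : [0,∞) → ℝⁿ satisfying ẍ(t) + γ ẋ(t) + α G_μ(x(t) + β ẋ(t)) = 0 for all t ≥ 0, and the unique minimizer x⋆ of F = f + g: ‖x(t) − x⋆‖² ≤ c₂ (‖x(0) − x⋆‖² + ‖ẋ(0)‖²) e^{−ρ t} for all t ≥ 0. -/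
open Set RealInnerProductSpace

noncomputable section

lemma AFB_subgrad {n : ℕ} (g : EuclideanSpace ℝ (Fin n) → ℝ) (hg : ConvexOn ℝ univ g)
    (p d : EuclideanSpace ℝ (Fin n)) (K : ℝ)
    (h : ∀ z, g p ≤ g z + ⟪d, z - p⟫ + K * ‖z - p‖ ^ 2) (z : EuclideanSpace ℝ (Fin n)) :
    g p ≤ g z + ⟪d, z - p⟫ := by
  have key : ∀ θ : ℝ, 0 < θ → θ ≤ 1 → g p ≤ g z + ⟪d, z - p⟫ + θ * (K * ‖z - p‖ ^ 2) := by
    intro θ h0 h1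
    have e : (1 - θ) • p + θ • z = p + θ • (z - p) := by module
    have hc := hg.2 (mem_univ p) (mem_univ z) (sub_nonneg.2 h1) h0.le (by ring)
    have h2 := h (p + θ • (z - p))
    rw [e] at hc
    simp only [add_sub_cancel_left, inner_smul_right, norm_smul, Real.norm_eq_abs, mul_pow, sq_abs,
      smul_eq_mul] at h2 hc
    have : θ * g p ≤ θ * (g z + ⟪d, z - p⟫ + θ * (K * ‖z - p‖ ^ 2)) := by nlinarith
    exact le_of_mul_le_mul_left this h0
  have ht : Filter.Tendsto (fun θ : ℝ => g z + ⟪d, z - p⟫ + θ * (K * ‖z - p‖ ^ 2))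
      (nhdsWithin 0 (Ioi 0)) (nhds (g z + ⟪d, z - p⟫ + 0 * (K * ‖z - p‖ ^ 2))) := by
    apply Filter.Tendsto.mono_left _ nhdsWithin_le_nhds
    exact Continuous.tendsto (by fun_prop) _
  rw [zero_mul, add_zero] at ht
  refine ge_of_tendsto ht ?_
  filter_upwards [Ioc_mem_nhdsGT (zero_lt_one' ℝ)] with θ hθ
  exact key θ hθ.1 hθ.2

lemma AFB_scalar (s ρ β γ c : ℝ) (h0 : 0 < s) (h1 : s < 1) (hρ : ρ = s - s ^ 2 / 2)
    (hγ : γ = 2 * s / (s + 1)) (hβ : β = 1 - γ) (hc : c = 1 - β * γ + ρ * β) :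
    0 < ρ ∧ ρ ^ 2 ≤ s ^ 2 ∧ 0 ≤ β ∧ γ + s ^ 2 * β = 2 * ρ ∧
    -(β ^ 2 * ρ * s ^ 2 / 2) + ρ - γ * c + ρ * c / 2 ≤ 0 ∧
    0 < s ^ 2 * β ^ 2 + c ∧
    0 < (s ^ 2 + ρ ^ 2) * (s ^ 2 * β ^ 2 + c) - (s ^ 2 * β + ρ) ^ 2 := by
  have hs : 0 < s + 1 := by linarith
  have hβ' : β = (1 - s) / (s + 1) := by rw [hβ, hγ]; field_simp; ring
  have hρ0 : 0 < ρ := by rw [hρ]; nlinarith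
  have hρs : ρ ≤ s := by rw [hρ]; nlinarith
  have hβ0 : 0 ≤ β := by rw [hβ']; apply div_nonneg <;> linarith
  have hc' : c = ((1 + 3 * s ^ 2) + (s - s ^ 2 / 2) * (1 - s ^ 2)) / (s + 1) ^ 2 := by
    rw [hc, hβ', hγ, hρ]; field_simp; ring
  have hc0 : 0 < c := by
    rw [hc']
    have : 0 < (s - s ^ 2 / 2) * (1 - s ^ 2) := mul_pos (by nlinarith) (by nlinarith)
    positivity
  refine ⟨hρ0, by nlinarith, hβ0, ?_, ?_, by positivity, ?_⟩
  · rw [hβ', hγ, hρ]; field_simp; ring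
  · have e : -(β ^ 2 * ρ * s ^ 2 / 2) + ρ - γ * c + ρ * c / 2 =
        s * (-1/2 + 5/4 * s - 11/4 * s ^ 2 + 17/8 * s ^ 3 - 15/8 * s ^ 4 - 3/8 * s ^ 5
          + 1/8 * s ^ 6) / (s + 1) ^ 3 := by
      rw [hc', hβ', hγ, hρ]; field_simp; ring
    rw [e]
    have h1s : 0 ≤ 1 - s := by linarith
    have : -1/2 + 5/4 * s - 11/4 * s ^ 2 + 17/8 * s ^ 3 - 15/8 * s ^ 4 - 3/8 * s ^ 5
          + 1/8 * s ^ 6 ≤ 0 := by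
      linarith [(by positivity : 0 ≤ s ^ 0 * (1 - s) ^ 6), (by positivity : 0 ≤ s ^ 1 * (1 - s) ^ 5), (by positivity : 0 ≤ s ^ 2 * (1 - s) ^ 4), (by positivity : 0 ≤ s ^ 3 * (1 - s) ^ 3), (by positivity : 0 ≤ s ^ 4 * (1 - s) ^ 2), (by positivity : 0 ≤ s ^ 5 * (1 - s) ^ 1), (by positivity : 0 ≤ s ^ 6 * (1 - s) ^ 0)]
    apply div_nonpos_of_nonpos_of_nonneg
    · exact mul_nonpos_of_nonneg_of_nonpos h0.le this
    · positivity
  · have e : (s ^ 2 + ρ ^ 2) * (s ^ 2 * β ^ 2 + c) - (s ^ 2 * β + ρ) ^ 2 =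
        s ^ 2 * (1 - 2 * s + 7 * s ^ 2 - 19/4 * s ^ 3 + 37/8 * s ^ 4 - 9/4 * s ^ 5
          + 3/8 * s ^ 6) / (s + 1) ^ 2 := by
      rw [hc', hβ', hρ]; field_simp; ring
    rw [e]
    have h1s : 0 ≤ 1 - s := by linarith
    have : 0 < 1 - 2 * s + 7 * s ^ 2 - 19/4 * s ^ 3 + 37/8 * s ^ 4 - 9/4 * s ^ 5
          + 3/8 * s ^ 6 := by
      linarith [(by positivity : 0 ≤ s ^ 0 * (1 - s) ^ 6), (by positivity : 0 ≤ s ^ 1 * (1 - s) ^ 5), (by positivity : 0 ≤ s ^ 2 * (1 - s) ^ 4), (by positivity : 0 ≤ s ^ 3 * (1 - s) ^ 3), (by positivity : 0 ≤ s ^ 4 * (1 - s) ^ 2), (by positivity : 0 ≤ s ^ 5 * (1 - s) ^ 1), (by positivity : 0 ≤ s ^ 6 * (1 - s) ^ 0)]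
    positivity

set_option maxHeartbeats 2000000 in
lemma AFB_dyn {n : ℕ}
    (P : EuclideanSpace ℝ (Fin n) →L[ℝ] EuclideanSpace ℝ (Fin n))
    (Φ : EuclideanSpace ℝ (Fin n) → ℝ) (G : EuclideanSpace ℝ (Fin n) → EuclideanSpace ℝ (Fin n))
    (α mt K δ s ρ β γ : ℝ) (hα : 0 < α) (hδ : 0 < δ) (hK : 0 ≤ K) (h0 : 0 < s) (h1 : s < 1)
    (hs : s ^ 2 = α * mt) (hρ : ρ = s - s ^ 2 / 2)
    (hγ : γ = 2 * s / (s + 1)) (hβ : β = 1 - γ)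
    (hPs : ∀ x y, ⟪P x, y⟫ = ⟪P y, x⟫)
    (hPl : ∀ x, δ * ‖x‖ ^ 2 ≤ ⟪P x, x⟫) (hPu : ∀ x, ⟪P x, x⟫ ≤ ‖x‖ ^ 2)
    (hlow : ∀ y z, Φ y + ⟪P (G y), z - y⟫ + mt / 2 * ⟪P (z - y), z - y⟫ ≤ Φ z)
    (hup : ∀ y z, Φ z ≤ Φ y + ⟪P (G y), z - y⟫ + K * ‖z - y‖ ^ 2) :
    ∃ c > (0 : ℝ), ∀ x v a : ℝ → EuclideanSpace ℝ (Fin n),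
      (∀ t ∈ Ici (0 : ℝ), HasDerivWithinAt x (v t) (Ici 0) t) →
      (∀ t ∈ Ici (0 : ℝ), HasDerivWithinAt v (a t) (Ici 0) t) →
      (∀ t ∈ Ici (0 : ℝ), a t + γ • v t + α • G (x t + β • v t) = 0) →
      ∀ xs, G xs = 0 →
        ∀ t ∈ Ici (0 : ℝ),
          ‖x t - xs‖ ^ 2 ≤
            c * (‖x 0 - xs‖ ^ 2 + ‖v 0‖ ^ 2) * Real.exp (-ρ * t) := by
  obtain ⟨c, hc⟩ : ∃ c, c = 1 - β * γ + ρ * β := ⟨_, rfl⟩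
  obtain ⟨hρ0, hρs, hβ0, hsum, hC, hd, hdet⟩ := AFB_scalar s ρ β γ c h0 h1 hρ hγ hβ hc
  set d := s ^ 2 * β ^ 2 + c with hd_def
  set D := (s ^ 2 + ρ ^ 2) * d - (s ^ 2 * β + ρ) ^ 2 with hD_def
  have hmt : 0 ≤ mt := by
    by_contra hcon
    have : α * mt < 0 := mul_neg_of_pos_of_neg hα (not_le.1 hcon)
    nlinarith
  have hP0 : ∀ x, 0 ≤ ⟪P x, x⟫ := fun x => le_trans (by positivity) (hPl x)
  have hder : ∀ y, HasFDerivAt Φ (innerSL ℝ (P (G y))) y := by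
    intro y
    rw [hasFDerivAt_iff_isLittleO_nhds_zero]
    have hO : (fun h : EuclideanSpace ℝ (Fin n) => Φ (y + h) - Φ y - innerSL ℝ (P (G y)) h)
        =O[nhds 0] (fun h => ‖h‖ ^ 2) := by
      apply Asymptotics.IsBigO.of_bound K
      filter_upwards with h
      have a1 := hlow y (y + h)
      have a2 := hup y (y + h)
      simp only [add_sub_cancel_left] at a1 a2
      have a3 : 0 ≤ mt / 2 * ⟪P h, h⟫ := mul_nonneg (by linarith) (hP0 h)
      rw [innerSL_apply_apply, Real.norm_eq_abs, Real.norm_eq_abs, abs_of_nonneg (by linarith),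
        abs_of_nonneg (by positivity)]
      linarith
    refine hO.trans_isLittleO ?_
    have := Asymptotics.isLittleO_norm_pow_id (E' := EuclideanSpace ℝ (Fin n)) (n := 2) (by norm_num)
    exact this
  set M := α * K * 2 * (1 + β ^ 2) + ρ ^ 2 + ρ + |c| with hM
  have hMpos : 0 < M := by positivity
  refine ⟨2 * d / (D * δ) * M, by positivity, ?_⟩
  intro x v a hx hv ha xs hxs t ht
  let V : ℝ → ℝ := fun t => α * (Φ (x t + β • v t) - Φ xs) +
    1 / 2 * (ρ ^ 2 * ⟪P (x t - xs), x t - xs⟫ + 2 * ρ * ⟪P (x t - xs), v t⟫ + c * ⟪P (v t), v t⟫)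
  have hV' : ∀ t ∈ Ici (0 : ℝ), ∃ V', HasDerivWithinAt V V' (Ici 0) t ∧ V' + ρ * V t ≤ 0 := by
    intro t ht
    have hX := (hx t ht).sub_const xs
    have hPX : HasDerivWithinAt (fun t => P (x t - xs)) (P (v t)) (Ici 0) t :=
      P.hasFDerivAt.comp_hasDerivWithinAt t hX
    have hPv : HasDerivWithinAt (fun t => P (v t)) (P (a t)) (Ici 0) t :=
      P.hasFDerivAt.comp_hasDerivWithinAt t (hv t ht)
    have hy := (hx t ht).add ((hv t ht).const_smul β)
    have hΦ : HasDerivWithinAt (fun t => Φ (x t + β • v t))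
        (⟪P (G (x t + β • v t)), v t + β • a t⟫) (Ici 0) t :=
      (hder (x t + β • v t)).comp_hasDerivWithinAt (f := fun t => x t + β • v t) t hy
    have hVd := ((hΦ.sub_const (Φ xs)).const_mul α).add
      (((((hPX.inner ℝ hX).const_mul (ρ ^ 2)).add ((hPX.inner ℝ (hv t ht)).const_mul (2 * ρ))).add
        ((hPv.inner ℝ (hv t ht)).const_mul c)).const_mul (1 / 2))
    refine ⟨_, hVd, ?_⟩
    have hat : a t = -γ • v t - α • G (x t + β • v t) := by
      have := ha t ht
      rw [← sub_eq_zero, ← this]; module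
    have hsc := hlow (x t + β • v t) xs
    simp only [V]
    rw [hat]
    generalize G (x t + β • v t) = g at *
    generalize Φ (x t + β • v t) = φ at *
    have e1 : xs - (x t + β • v t) = -((x t - xs) + β • v t) := by module
    rw [e1] at hsc
    generalize x t - xs = X at *
    generalize v t = w at *
    simp only [map_add, map_sub, map_neg, map_smul, inner_add_left, inner_add_right, inner_sub_left,
      inner_sub_right, inner_neg_left, inner_neg_right, inner_smul_left, inner_smul_right,
      neg_smul, conj_trivial] at hsc ⊢
    rw [hPs w X, hPs g w, hPs g X] at *
    have hgg := hP0 g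
    have hXX := hP0 X
    have hww := hP0 w
    generalize ⟪P X, X⟫ = XX at *
    generalize ⟪P X, w⟫ = Xw at *
    generalize ⟪P w, w⟫ = ww at *
    generalize ⟪P g, g⟫ = gg at *
    generalize ⟪P X, g⟫ = gX at *
    generalize ⟪P w, g⟫ = gw at *
    have hsc2 : α * (φ - Φ xs) + s ^ 2 / 2 * (XX + 2 * β * Xw + β ^ 2 * ww)
        ≤ α * (gX + β * gw) := by
      rw [hs]
      have := mul_le_mul_of_nonneg_left hsc hα.le
      linarith
    have b1 := mul_le_mul_of_nonneg_left hsc2 hρ0.le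
    have b2 : (-(β ^ 2 * ρ * s ^ 2 / 2) + ρ - γ * c + ρ * c / 2) * ww ≤ 0 :=
      mul_nonpos_of_nonpos_of_nonneg hC hww
    have b3 : 0 ≤ α ^ 2 * β * gg := by positivity
    have b4 : 0 ≤ ρ * (s ^ 2 - ρ ^ 2) * XX :=
      mul_nonneg (mul_nonneg hρ0.le (by linarith)) hXX
    have b5 : ρ * (γ + s ^ 2 * β) * Xw = ρ * (2 * ρ) * Xw := by rw [hsum]
    have b6 : c * α * gw = (1 - β * γ + ρ * β) * α * gw := by rw [← hc]
    linarith
  have hE : AntitoneOn (fun t => V t * Real.exp (ρ * t)) (Ici 0) := by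
    choose! V' hVd hVn using hV'
    have hd1 : ∀ t ∈ Ici (0 : ℝ), HasDerivWithinAt (fun t => V t * Real.exp (ρ * t))
        ((V' t + ρ * V t) * Real.exp (ρ * t)) (Ici 0) t := by
      intro t ht
      have he : HasDerivWithinAt (fun t : ℝ => Real.exp (ρ * t)) (Real.exp (ρ * t) * (ρ * 1)) (Ici 0) t :=
        (((hasDerivAt_id t).const_mul ρ).exp).hasDerivWithinAt
      refine ((hVd t ht).mul he).congr_deriv ?_
      ring
    apply antitoneOn_of_hasDerivWithinAt_nonpos (convex_Ici 0)
      (f' := fun t => (V' t + ρ * V t) * Real.exp (ρ * t))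
    · exact fun t ht => (hd1 t ht).continuousWithinAt
    · exact fun t ht => (hd1 t (interior_subset ht)).mono interior_subset
    · exact fun t ht => mul_nonpos_of_nonpos_of_nonneg (hVn t (interior_subset ht))
        (Real.exp_pos _).le
  have hmono := hE (mem_Ici.2 le_rfl) ht ht
  simp only [mul_zero, Real.exp_zero, mul_one] at hmono
  have hlowV : D * δ / (2 * d) * ‖x t - xs‖ ^ 2 ≤ V t := by
    have hsc := hlow xs (x t + β • v t)
    rw [hxs] at hsc
    have e1 : (x t + β • v t) - xs = (x t - xs) + β • v t := by module
    rw [e1] at hsc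
    simp only [V]
    have hδX := hPl (x t - xs)
    generalize x t - xs = X at *
    generalize v t = w at *
    have hsq := hP0 (d • w + (s ^ 2 * β + ρ) • X)
    simp only [map_add, map_smul, map_zero, inner_zero_left, inner_add_left, inner_add_right,
      inner_smul_left, inner_smul_right, conj_trivial] at hsc hsq
    rw [hPs w X] at *
    have c1 := mul_le_mul_of_nonneg_left hδX hdet.le
    generalize ⟪P X, X⟫ = XX at *
    generalize ⟪P X, w⟫ = Xw at *
    generalize ⟪P w, w⟫ = ww at *
    have c2 := mul_le_mul_of_nonneg_left hsc (mul_pos hα hd).le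
    rw [div_mul_eq_mul_div, div_le_iff₀ (by positivity)]
    have c3 : α * mt * d * (XX + 2 * β * Xw + β ^ 2 * ww)
       = s ^ 2 * d * (XX + 2 * β * Xw + β ^ 2 * ww) := by rw [hs]
    have c4 : D * XX = ((s ^ 2 + ρ ^ 2) * d - (s ^ 2 * β + ρ) ^ 2) * XX := by rw [hD_def]
    have c5 : d * d * ww = d * (s ^ 2 * β ^ 2 + c) * ww := by rw [← hd_def]
    linarith
  have hupV : V 0 ≤ M * (‖x 0 - xs‖ ^ 2 + ‖v 0‖ ^ 2) := by
    have hsc := hup xs (x 0 + β • v 0)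
    rw [hxs] at hsc
    have e1 : (x 0 + β • v 0) - xs = (x 0 - xs) + β • v 0 := by module
    rw [e1] at hsc
    simp only [V]
    generalize x 0 - xs = X at *
    generalize v 0 = w at *
    have n1 : ‖X + β • w‖ ^ 2 ≤ 2 * (1 + β ^ 2) * (‖X‖ ^ 2 + ‖w‖ ^ 2) := by
      have := norm_add_le X (β • w)
      rw [norm_smul, Real.norm_eq_abs, abs_of_nonneg hβ0] at this
      have h3 : ‖X + β • w‖ ^ 2 ≤ (‖X‖ + β * ‖w‖) ^ 2 := by gcongr
      have h4 : 2 * (1 + β ^ 2) * (‖X‖ ^ 2 + ‖w‖ ^ 2) = (‖X‖ + β * ‖w‖) ^ 2 + (‖X‖ - β * ‖w‖) ^ 2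
        + 2 * (β * ‖X‖) ^ 2 + 2 * ‖w‖ ^ 2 := by ring
      rw [h4]
      have h5 : 0 ≤ (‖X‖ - β * ‖w‖) ^ 2 + 2 * (β * ‖X‖) ^ 2 + 2 * ‖w‖ ^ 2 := by positivity
      linarith only [h3, h5]
    simp only [map_zero, inner_zero_left, add_zero] at hsc
    have n2 : 2 * ⟪P X, w⟫ ≤ ‖X‖ ^ 2 + ‖w‖ ^ 2 := by
      have := hP0 (X - w)
      simp only [map_sub, inner_sub_left, inner_sub_right] at this
      rw [hPs w X] at this
      linarith [hPu X, hPu w]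
    have n3 : c * ⟪P w, w⟫ ≤ |c| * (‖X‖ ^ 2 + ‖w‖ ^ 2) := by
      apply mul_le_mul (le_abs_self c) _ (hP0 w) (abs_nonneg c)
      linarith [hPu w, sq_nonneg ‖X‖]
    have n4 : α * (Φ (x 0 + β • w) - Φ xs) ≤ α * K * 2 * (1 + β ^ 2) * (‖X‖ ^ 2 + ‖w‖ ^ 2) := by
      have := mul_le_mul_of_nonneg_left n1 hK
      have h5 : Φ (x 0 + β • w) - Φ xs ≤ K * (2 * (1 + β ^ 2) * (‖X‖ ^ 2 + ‖w‖ ^ 2)) := by linarith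
      have := mul_le_mul_of_nonneg_left h5 hα.le
      linarith
    have n5 : ρ ^ 2 * ⟪P X, X⟫ ≤ ρ ^ 2 * (‖X‖ ^ 2 + ‖w‖ ^ 2) := by
      gcongr
      linarith [hPu X, sq_nonneg ‖w‖]
    have n6 := mul_le_mul_of_nonneg_left n2 hρ0.le
    have n7 : 0 ≤ ‖X‖ ^ 2 + ‖w‖ ^ 2 := by positivity
    have n8 : 0 ≤ ρ ^ 2 * (‖X‖ ^ 2 + ‖w‖ ^ 2) := by positivity
    have n9 : 0 ≤ ρ * (‖X‖ ^ 2 + ‖w‖ ^ 2) := by positivity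
    have n10 : 0 ≤ |c| * (‖X‖ ^ 2 + ‖w‖ ^ 2) := by positivity
    rw [hM]
    linarith
  have hfin : V t ≤ M * (‖x 0 - xs‖ ^ 2 + ‖v 0‖ ^ 2) * Real.exp (-ρ * t) := by
    have : V t = V t * Real.exp (ρ * t) * Real.exp (-ρ * t) := by
      rw [mul_assoc, ← Real.exp_add]; simp
    rw [this]
    exact mul_le_mul_of_nonneg_right (hmono.trans hupV) (Real.exp_pos _).le
  have hq : 0 < D * δ / (2 * d) := by positivity
  have h9 := hlowV.trans hfin
  rw [← le_div_iff₀' hq] at h9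
  refine h9.trans (le_of_eq ?_)
  field_simp

/-- Theorem 2, forward–backward case: accelerated exponential
convergence of the accelerated forward–backward splitting dynamics for a
strongly convex quadratic `f` plus a convex lower semicontinuous `g`. -/
theorem accelerated_FB_strongly_convex_quadratic {n : ℕ}
    (Q : EuclideanSpace ℝ (Fin n) →L[ℝ] EuclideanSpace ℝ (Fin n))
    (q : EuclideanSpace ℝ (Fin n)) (g : EuclideanSpace ℝ (Fin n) → ℝ)
    (m L μ α mt γ β ρ : ℝ)
    (hQsym : ∀ x y : EuclideanSpace ℝ (Fin n), ⟪Q x, y⟫ = ⟪x, Q y⟫)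
    (hm : 0 < m)
    (hQm : ∀ x : EuclideanSpace ℝ (Fin n), m * ‖x‖ ^ 2 ≤ ⟪x, Q x⟫)
    (hQmmin : ∃ x : EuclideanSpace ℝ (Fin n), x ≠ 0 ∧ ⟪x, Q x⟫ = m * ‖x‖ ^ 2)
    (hQL : ∀ x : EuclideanSpace ℝ (Fin n), ⟪x, Q x⟫ ≤ L * ‖x‖ ^ 2)
    (hQLmax : ∃ x : EuclideanSpace ℝ (Fin n), x ≠ 0 ∧ ⟪x, Q x⟫ = L * ‖x‖ ^ 2)
    (f F : EuclideanSpace ℝ (Fin n) → ℝ)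
    (hf : ∀ x, f x = (1 / 2) * ⟪x, Q x⟫ + ⟪q, x⟫)
    (hF : ∀ x, F x = f x + g x)
    (hgconv : ConvexOn ℝ univ g) (hglsc : LowerSemicontinuous g)
    (hμ : μ ∈ Ioo 0 (1 / L))
    (hmt : mt = min ((1 - μ * m) * m) ((1 - μ * L) * L))
    (hα : 0 < α) (hαmt : α * mt < 1)
    (hγ : γ = 2 * Real.sqrt (α * mt) / (Real.sqrt (α * mt) + 1))
    (hβ : β = 1 - γ)
    (hρ : ρ = Real.sqrt (α * mt) - α * mt / 2)
    (proxg : EuclideanSpace ℝ (Fin n) → EuclideanSpace ℝ (Fin n))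
    (hproxg : ∀ v, IsMinOn (fun z => g z + ‖z - v‖ ^ 2 / (2 * μ)) univ (proxg v))
    (G : EuclideanSpace ℝ (Fin n) → EuclideanSpace ℝ (Fin n))
    (hG : ∀ x, G x = μ⁻¹ • (x - proxg (x - μ • gradient f x))) :
    ∃ c > (0 : ℝ), ∀ x v a : ℝ → EuclideanSpace ℝ (Fin n),
      (∀ t ∈ Ici (0 : ℝ), HasDerivWithinAt x (v t) (Ici 0) t) →
      (∀ t ∈ Ici (0 : ℝ), HasDerivWithinAt v (a t) (Ici 0) t) →
      ContinuousOn a (Ici 0) →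
      (∀ t ∈ Ici (0 : ℝ), a t + γ • v t + α • G (x t + β • v t) = 0) →
      ∀ xs, IsMinOn F univ xs →
        ∀ t ∈ Ici (0 : ℝ),
          ‖x t - xs‖ ^ 2 ≤
            c * (‖x 0 - xs‖ ^ 2 + ‖v 0‖ ^ 2) * Real.exp (-ρ * t) := by
  obtain ⟨hμ0, hμL'⟩ := hμ
  have hmL : m ≤ L := by
    obtain ⟨x, hx, hxe⟩ := hQLmax
    have := hQm x
    rw [hxe] at this
    exact le_of_mul_le_mul_right this (by positivity)
  have hL : 0 < L := hm.trans_le hmL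
  have hμL : μ * L < 1 := by rwa [lt_div_iff₀ hL] at hμL'
  have hμm : μ * m < 1 := lt_of_le_of_lt (by gcongr) hμL
  have hmt0 : 0 < mt := by
    rw [hmt]
    exact lt_min (mul_pos (by linarith) hm) (mul_pos (by linarith) hL)
  have hmtm : mt ≤ m := by
    rw [hmt]
    refine (min_le_left _ _).trans ?_
    nlinarith [mul_pos hμ0 (mul_pos hm hm)]
  have hgrad : ∀ x, gradient f x = Q x + q := by
    intro x
    apply HasGradientAt.gradient
    have hfe : f = fun x => (1 / 2) * ⟪x, Q x⟫ + ⟪q, x⟫ := funext hf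
    rw [hasGradientAt_iff_hasFDerivAt, hfe]
    have h1 := (((hasFDerivAt_id (𝕜 := ℝ) x).inner ℝ (Q.hasFDerivAt (x := x))).const_mul (1 / 2)).add
      ((innerSL ℝ q).hasFDerivAt (x := x))
    refine h1.congr_fderiv (ContinuousLinearMap.ext fun h => ?_)
    simp [inner_add_left, fderivInnerCLM_apply]
    rw [← hQsym x h, real_inner_comm h (Q x), real_inner_comm (Q x) h]
    ring
  have hprox : ∀ w z, g (proxg w) + ⟪μ⁻¹ • (w - proxg w), z - proxg w⟫ ≤ g z := by
    intro w z
    have := AFB_subgrad g hgconv (proxg w) (μ⁻¹ • (proxg w - w)) (1 / (2 * μ)) (by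
      intro z
      have h1 := hproxg w (mem_univ z)
      simp only [mem_ofPred_eq] at h1
      have h2 : z - w = (proxg w - w) + (z - proxg w) := by abel
      rw [h2, norm_add_sq_real] at h1
      rw [inner_smul_left, conj_trivial]
      have h3 : (‖proxg w - w‖ ^ 2 + 2 * ⟪proxg w - w, z - proxg w⟫ + ‖z - proxg w‖ ^ 2) / (2 * μ)
        = ‖proxg w - w‖ ^ 2 / (2 * μ) + μ⁻¹ * ⟪proxg w - w, z - proxg w⟫
          + 1 / (2 * μ) * ‖z - proxg w‖ ^ 2 := by field_simp
      linarith) z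
    have h4 : μ⁻¹ • (proxg w - w) = -(μ⁻¹ • (w - proxg w)) := by module
    rw [h4, inner_neg_left] at this
    linarith
  let P : EuclideanSpace ℝ (Fin n) →L[ℝ] EuclideanSpace ℝ (Fin n) :=
    ContinuousLinearMap.id ℝ _ - μ • Q
  have hP : ∀ x, P x = x - μ • Q x := fun x => rfl
  let e : EuclideanSpace ℝ (Fin n) → ℝ := fun w => g (proxg w) + μ / 2 * ‖μ⁻¹ • (w - proxg w)‖ ^ 2
  have helow : ∀ w w', e w + ⟪μ⁻¹ • (w - proxg w), w' - w⟫ ≤ e w' := by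
    intro w w'
    have h1 := hprox w (proxg w')
    simp only [e]
    obtain ⟨d, hd⟩ : ∃ d, d = μ⁻¹ • (w - proxg w) := ⟨_, rfl⟩
    obtain ⟨d', hd'⟩ : ∃ d', d' = μ⁻¹ • (w' - proxg w') := ⟨_, rfl⟩
    have h2 : proxg w' - proxg w = (w' - w) - μ • (d' - d) := by
      rw [hd, hd', smul_sub, smul_inv_smul₀ hμ0.ne', smul_inv_smul₀ hμ0.ne']; abel
    rw [← hd, h2] at h1
    rw [← hd, ← hd']
    rw [inner_sub_right, inner_smul_right, inner_sub_right d d' d, real_inner_self_eq_norm_sq] at h1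
    have h3 : 0 ≤ μ / 2 * ‖d' - d‖ ^ 2 := by positivity
    rw [norm_sub_sq_real, real_inner_comm] at h3
    linarith
  have heup : ∀ w w', e w' ≤ e w + ⟪μ⁻¹ • (w - proxg w), w' - w⟫ + 1 / (2 * μ) * ‖w' - w‖ ^ 2 := by
    intro w w'
    have h1 := hproxg w' (mem_univ (proxg w))
    simp only [mem_ofPred_eq] at h1
    have h2 : proxg w - w' = -((w - proxg w) + (w' - w)) := by abel
    have h3 : proxg w' - w' = -(w' - proxg w') := by abel
    rw [h2, h3, norm_neg, norm_neg, norm_add_sq_real] at h1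
    simp only [e, norm_smul, mul_pow, inner_smul_left, conj_trivial, Real.norm_eq_abs, sq_abs]
    have h4 : (‖w - proxg w‖ ^ 2 + 2 * ⟪w - proxg w, w' - w⟫ + ‖w' - w‖ ^ 2) / (2 * μ)
        = μ / 2 * (μ⁻¹ ^ 2 * ‖w - proxg w‖ ^ 2) + μ⁻¹ * ⟪w - proxg w, w' - w⟫
          + 1 / (2 * μ) * ‖w' - w‖ ^ 2 := by field_simp
    have h5 : ‖w' - proxg w'‖ ^ 2 / (2 * μ) = μ / 2 * (μ⁻¹ ^ 2 * ‖w' - proxg w'‖ ^ 2) := by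
      field_simp
    linarith
  let Φ : EuclideanSpace ℝ (Fin n) → ℝ := fun y =>
    1 / 2 * ⟪y, Q y⟫ + ⟪q, y⟫ - μ / 2 * ‖Q y + q‖ ^ 2 + e (y - μ • (Q y + q))
  have hGd : ∀ y, G y = (Q y + q) + μ⁻¹ • ((y - μ • (Q y + q)) - proxg (y - μ • (Q y + q))) := by
    intro y
    rw [hG, hgrad, sub_right_comm, smul_sub μ⁻¹ _ (μ • (Q y + q)), inv_smul_smul₀ hμ0.ne']
    abel
  have hPs : ∀ x y, ⟪P x, y⟫ = ⟪P y, x⟫ := by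
    intro x y
    rw [hP, hP, inner_sub_left, inner_sub_left, inner_smul_left, inner_smul_left, hQsym x y,
      real_inner_comm x y, real_inner_comm x (Q y)]
  have hquad : ∀ y h, 1 / 2 * ⟪y + h, Q (y + h)⟫ + ⟪q, y + h⟫ - μ / 2 * ‖Q (y + h) + q‖ ^ 2
      = 1 / 2 * ⟪y, Q y⟫ + ⟪q, y⟫ - μ / 2 * ‖Q y + q‖ ^ 2 + ⟪P (Q y + q), h⟫
        + 1 / 2 * ⟪P h, Q h⟫ := by
    intro y h
    have e1 : Q (y + h) + q = (Q y + q) + Q h := by rw [map_add]; abel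
    rw [e1, norm_add_sq_real, hP, hP, map_add]
    simp only [inner_add_left, inner_add_right, inner_sub_left, inner_smul_left, conj_trivial,
      map_add, smul_add, hQsym, ← real_inner_self_eq_norm_sq]
    rw [real_inner_comm (Q y) h, hQsym y h]
    ring
  have hstep : ∀ y h, (y + h) - μ • (Q (y + h) + q) - (y - μ • (Q y + q)) = P h := by
    intro y h
    rw [hP, map_add]; module
  have hPnn : ∀ h, ‖P h‖ ^ 2 = ⟪P h, h⟫ - μ * ⟪P h, Q h⟫ := by
    intro h
    rw [← real_inner_self_eq_norm_sq]
    nth_rewrite 2 [hP h]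
    rw [inner_sub_right, inner_smul_right]
  have hQP : ∀ h, m * ⟪P h, h⟫ ≤ ⟪P h, Q h⟫ := by
    intro h
    obtain ⟨ℓ, hℓ⟩ : ∃ ℓ, ℓ = μ⁻¹ - m := ⟨_, rfl⟩
    have hμi : μ * μ⁻¹ = 1 := mul_inv_cancel₀ hμ0.ne'
    have hLi : L ≤ μ⁻¹ := by
      rw [← one_div, le_div_iff₀ hμ0]; linarith
    have hℓ0 : 0 < ℓ := by
      rw [hℓ, sub_pos, ← one_div, lt_div_iff₀ hμ0]; linarith
    obtain ⟨r, hr⟩ : ∃ r, r = Q h - m • h := ⟨_, rfl⟩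
    have hQh : Q h = r + m • h := by rw [hr]; abel
    have h1 := hQm (ℓ • h - r)
    have h2 := hQL r
    have h2' : L * ‖r‖ ^ 2 ≤ μ⁻¹ * ‖r‖ ^ 2 := by gcongr
    have h3 : ⟪h, Q r⟫ = ⟪r, r⟫ + m * ⟪h, r⟫ := by
      rw [← hQsym, hQh, inner_add_left, inner_smul_left, conj_trivial]
    rw [← real_inner_self_eq_norm_sq] at h1 h2 h2'
    simp only [map_sub, map_smul, inner_sub_left, inner_sub_right, inner_smul_left,
      inner_smul_right, conj_trivial, h3, hQh, inner_add_right, real_inner_comm h r] at h1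
    have h4 : 0 ≤ ℓ * (ℓ * ⟪h, r⟫ - ⟪r, r⟫) := by
      have : μ⁻¹ = ℓ + m := by linarith
      rw [this] at h2'
      linarith
    have h5 : 0 ≤ ℓ * ⟪h, r⟫ - ⟪r, r⟫ := nonneg_of_mul_nonneg_right h4 hℓ0
    have h6 := mul_nonneg hμ0.le h5
    have h7 : μ * (ℓ * ⟪h, r⟫) = ⟪h, r⟫ - μ * m * ⟪h, r⟫ := by
      rw [hℓ, ← mul_assoc, mul_sub, hμi]; ring
    rw [hP, hQh]
    simp only [inner_sub_left, inner_add_left, inner_add_right, inner_smul_left,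
      inner_smul_right, conj_trivial, smul_add, real_inner_comm h r]
    linarith
  have hPu : ∀ x, ⟪P x, x⟫ ≤ ‖x‖ ^ 2 := by
    intro x
    rw [hP, inner_sub_left, inner_smul_left, conj_trivial, hQsym, real_inner_self_eq_norm_sq]
    have := mul_nonneg hμ0.le (le_trans (by positivity) (hQm x))
    linarith
  have hPl : ∀ x, (1 - μ * L) * ‖x‖ ^ 2 ≤ ⟪P x, x⟫ := by
    intro x
    rw [hP, inner_sub_left, inner_smul_left, conj_trivial, hQsym, real_inner_self_eq_norm_sq]
    have := mul_le_mul_of_nonneg_left (hQL x) hμ0.le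
    linarith
  have hδ : 0 < 1 - μ * L := by linarith
  have hlow : ∀ y z, Φ y + ⟪P (G y), z - y⟫ + mt / 2 * ⟪P (z - y), z - y⟫ ≤ Φ z := by
    intro y z
    obtain ⟨h, rfl⟩ : ∃ h, z = y + h := ⟨z - y, by abel⟩
    have h1 := helow (y - μ • (Q y + q)) ((y + h) - μ • (Q (y + h) + q))
    have h2 := hquad y h
    have h3 := hQP h
    have h0 : 0 ≤ ⟪P h, h⟫ := le_trans (by positivity) (hPl h)
    have h4 := mul_le_mul_of_nonneg_right hmtm h0
    rw [hstep, real_inner_comm, hPs] at h1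
    simp only [Φ, add_sub_cancel_left]
    rw [hGd y, map_add P, inner_add_left (P (Q y + q))]
    linarith [hPs h (μ⁻¹ • ((y - μ • (Q y + q)) - proxg (y - μ • (Q y + q))))]
  have hup : ∀ y z, Φ z ≤ Φ y + ⟪P (G y), z - y⟫ + (1 / (2 * μ)) * ‖z - y‖ ^ 2 := by
    intro y z
    obtain ⟨h, rfl⟩ : ∃ h, z = y + h := ⟨z - y, by abel⟩
    have h1 := heup (y - μ • (Q y + q)) ((y + h) - μ • (Q (y + h) + q))
    have h2 := hquad y h
    rw [hstep, real_inner_comm, hPs, hPnn] at h1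
    have h5 : 1 / (2 * μ) * (⟪P h, h⟫ - μ * ⟪P h, Q h⟫)
      = 1 / (2 * μ) * ⟪P h, h⟫ - 1 / 2 * ⟪P h, Q h⟫ := by field_simp
    have h6 : 1 / (2 * μ) * ⟪P h, h⟫ ≤ 1 / (2 * μ) * ‖h‖ ^ 2 := by
      have := hPu h
      gcongr
    simp only [Φ, add_sub_cancel_left]
    rw [hGd y, map_add P, inner_add_left (P (Q y + q))]
    linarith [hPs h (μ⁻¹ • ((y - μ • (Q y + q)) - proxg (y - μ • (Q y + q))))]
  have hGz : ∀ xs, IsMinOn F univ xs → G xs = 0 := by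
    intro xs hxs
    have h1 := AFB_subgrad g hgconv xs (Q xs + q) (L / 2) (by
      intro z
      have h1 := hxs (mem_univ z)
      simp only [mem_ofPred_eq] at h1
      obtain ⟨h, rfl⟩ : ∃ h, z = xs + h := ⟨z - xs, by abel⟩
      rw [hF, hF, hf, hf] at h1
      have h2 := hQL h
      rw [add_sub_cancel_left]
      simp only [map_add, inner_add_left, inner_add_right] at h1 ⊢
      rw [← hQsym xs h, real_inner_comm (Q xs) h] at h1
      linarith)
    have h2 := hprox (xs - μ • (Q xs + q)) xs
    have h3 := h1 (proxg (xs - μ • (Q xs + q)))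
    rw [hG, hgrad]
    generalize proxg (xs - μ • (Q xs + q)) = p at *
    have h4 : p - xs = -(xs - p) := by abel
    have h5 : μ⁻¹ • (xs - μ • (Q xs + q) - p) = μ⁻¹ • (xs - p) - (Q xs + q) := by
      rw [sub_right_comm, smul_sub, inv_smul_smul₀ hμ0.ne']
    rw [h4, inner_neg_right] at h3
    rw [h5, inner_sub_left, inner_smul_left, conj_trivial, real_inner_self_eq_norm_sq] at h2
    have h6 : μ⁻¹ * ‖xs - p‖ ^ 2 ≤ 0 := by linarith
    have h7 : ‖xs - p‖ ^ 2 ≤ 0 := by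
      by_contra hcon
      have := mul_pos (inv_pos.2 hμ0) (not_le.1 hcon)
      linarith
    have h8 : xs - p = 0 := by
      rw [← norm_eq_zero]
      exact pow_eq_zero_iff two_ne_zero |>.1 (le_antisymm h7 (by positivity))
    rw [h8, smul_zero]
  have hκ : 0 < α * mt := mul_pos hα hmt0
  have hsq : Real.sqrt (α * mt) ^ 2 = α * mt := Real.sq_sqrt hκ.le
  obtain ⟨c, hc, H⟩ := AFB_dyn P Φ G α mt (1 / (2 * μ)) (1 - μ * L) (Real.sqrt (α * mt)) ρ β γ hα hδ
    (by positivity) (Real.sqrt_pos.2 hκ) (by rw [Real.sqrt_lt' one_pos]; linarith) hsq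
    (by rw [hρ, hsq]) hγ hβ hPs hPl hPu hlow hup
  exact ⟨c, hc, fun x v a hx hv _ hode xs hxs t ht => H x v a hx hv hode xs (hGz xs hxs) t ht⟩
end
end

section
/- Let f : ℝⁿ → ℝ be twice continuously differentiable, m-strongly convex with m > 0, and have L-Lipschitz gradient, and let g : ℝⁿ → ℝ be convex and lower semicontinuous. Let α > 0 with α m < 1, γ = 2√(α m)/(√(α m) + 1), β = 1 − γ, ρ = √(α m) − α m / 2, and μ ∈ (0, √(γβ)/(2L)]. Then there exists c₃ > 0, depending only on f, g, μ, α, such that for every twice continuously differentiable x : [0,∞) → ℝⁿ satisfying ẍ(t) + γ ẋ(t) + α G_μ(x(t) + β ẋ(t)) = 0 for all t ≥ 0, and the unique minimizer x⋆ of F = f + g: ‖x(t) − x⋆‖² ≤ c₃ (‖x(0) − x⋆‖² + ‖ẋ(0)‖²) e^{−ρ t} for all t ≥ 0. -/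
open Set RealInnerProductSpace

noncomputable section

section helpers

variable {E : Type*} [NormedAddCommGroup E] [InnerProductSpace ℝ E]

lemma aux_limit {a b c : ℝ} (h : ∀ s : ℝ, 0 < s → s < 1 → a ≤ b + s * c) : a ≤ b := by
  by_contra hab
  push Not at hab
  have hc : 0 < |c| + 1 := by positivity
  set s := min (1/2) ((a - b) / (2 * (|c| + 1))) with hs
  have hs0 : 0 < s := lt_min (by norm_num) (div_pos (by linarith) (by positivity))
  have hs1 : s < 1 := lt_of_le_of_lt (min_le_left _ _) (by norm_num)
  have h1 := h s hs0 hs1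
  have h2 : s * (2 * (|c| + 1)) ≤ a - b := by
    rw [← le_div_iff₀ (by positivity)]; exact min_le_right _ _
  have h3 : s * c ≤ s * |c| := mul_le_mul_of_nonneg_left (le_abs_self c) hs0.le
  nlinarith

lemma prox_subgrad {g : E → ℝ} (hg : ConvexOn ℝ univ g) {μ : ℝ} (hμ : 0 < μ) {p u : E}
    (hp : IsMinOn (fun z => g z + ‖z - u‖ ^ 2 / (2 * μ)) univ p) (z : E) :
    g p + μ⁻¹ * ⟪u - p, z - p⟫ ≤ g z := by
  refine aux_limit (c := ‖z - p‖ ^ 2 / (2 * μ)) ?_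
  intro s hs0 hs1
  have h1 := hp (mem_univ (p + s • (z - p)))
  simp only [mem_ofPred_eq] at h1
  have h2 := hg.2 (mem_univ p) (mem_univ z) (by linarith : (0:ℝ) ≤ 1 - s) hs0.le (by ring)
  have e1 : (1 - s) • p + s • z = p + s • (z - p) := by module
  rw [e1] at h2
  simp only [smul_eq_mul] at h2
  have e2 : ‖p + s • (z - p) - u‖ ^ 2 = ‖p - u‖ ^ 2 - 2 * s * ⟪u - p, z - p⟫ + s ^ 2 * ‖z - p‖ ^ 2 := by
    have : p + s • (z - p) - u = s • (z - p) - (u - p) := by module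
    rw [this, norm_sub_sq_real, norm_smul, real_inner_smul_left, norm_sub_rev p u,
      real_inner_comm, mul_pow, Real.norm_eq_abs, sq_abs]
    ring
  rw [e2] at h1
  have h3 : s * (g p + μ⁻¹ * ⟪u - p, z - p⟫) ≤ s * (g z + s * (‖z - p‖ ^ 2 / (2 * μ))) := by
    have : (‖p - u‖ ^ 2 - 2 * s * ⟪u - p, z - p⟫ + s ^ 2 * ‖z - p‖ ^ 2) / (2 * μ)
      = ‖p - u‖ ^ 2 / (2 * μ) - s * (μ⁻¹ * ⟪u - p, z - p⟫) + s * (s * (‖z - p‖ ^ 2 / (2 * μ))) := by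
      field_simp
    rw [this] at h1
    nlinarith
  exact le_of_mul_le_mul_left h3 hs0

lemma moreau_deriv {g : E → ℝ} (hg : ConvexOn ℝ univ g) {μ : ℝ} (hμ : 0 < μ) {p : E → E}
    (hp : ∀ u, IsMinOn (fun z => g z + ‖z - u‖ ^ 2 / (2 * μ)) univ (p u)) (u : E) :
    HasFDerivAt (fun w => g (p w) + ‖p w - w‖ ^ 2 / (2 * μ))
      (innerSL ℝ (μ⁻¹ • (u - p u))) u := by
  rw [hasFDerivAt_iff_isLittleO_nhds_zero]
  have hO : (fun h : E => (g (p (u + h)) + ‖p (u + h) - (u + h)‖ ^ 2 / (2 * μ)) -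
      (g (p u) + ‖p u - u‖ ^ 2 / (2 * μ)) - (innerSL ℝ (μ⁻¹ • (u - p u))) h)
      =O[nhds 0] (fun h : E => ‖h‖ ^ 2) := by
    refine Asymptotics.IsBigO.of_bound (1 / (2 * μ)) (Filter.Eventually.of_forall fun h => ?_)
    rw [innerSL_apply_apply, real_inner_smul_left, Real.norm_eq_abs, Real.norm_eq_abs,
      abs_of_nonneg (sq_nonneg ‖h‖), abs_le]
    have h1 := hp (u + h) (mem_univ (p u))
    simp only [mem_ofPred_eq] at h1
    have h2 := prox_subgrad hg hμ (hp u) (p (u + h))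
    set P := p (u + h)
    set Q := p u
    have e1 : ‖Q - (u + h)‖ ^ 2 = ‖Q - u‖ ^ 2 + 2 * ⟪u - Q, h⟫ + ‖h‖ ^ 2 := by
      have : Q - (u + h) = - ((u - Q) + h) := by abel
      rw [this, norm_neg, norm_add_sq_real, norm_sub_rev Q u]
    have e2 : ‖P - (u + h)‖ ^ 2 - ‖Q - u‖ ^ 2 - 2 * ⟪u - Q, h⟫ + 2 * ⟪u - Q, P - Q⟫
        = ‖(P - Q) - h‖ ^ 2 := by
      have a1 : P - (u + h) = ((P - Q) - h) - (u - Q) := by abel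
      rw [a1, norm_sub_sq_real ((P - Q) - h) (u - Q), norm_sub_rev Q u,
        real_inner_comm (u - Q) (P - Q - h), inner_sub_right (u - Q) (P - Q) h]
      ring
    constructor
    · have h3 : 0 ≤ (2 * μ)⁻¹ * (‖P - (u + h)‖ ^ 2 - ‖Q - u‖ ^ 2 - 2 * ⟪u - Q, h⟫ + 2 * ⟪u - Q, P - Q⟫) := by
        rw [e2]; positivity
      have h4 : (2 * μ)⁻¹ * (‖P - (u + h)‖ ^ 2 - ‖Q - u‖ ^ 2 - 2 * ⟪u - Q, h⟫ + 2 * ⟪u - Q, P - Q⟫)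
        = ‖P - (u + h)‖ ^ 2 / (2 * μ) - ‖Q - u‖ ^ 2 / (2 * μ) - μ⁻¹ * ⟪u - Q, h⟫ + μ⁻¹ * ⟪u - Q, P - Q⟫ := by
        field_simp
      have h5 : 0 ≤ 1 / (2 * μ) * ‖h‖ ^ 2 := by positivity
      linarith
    · rw [e1] at h1
      have h4 : (‖Q - u‖ ^ 2 + 2 * ⟪u - Q, h⟫ + ‖h‖ ^ 2) / (2 * μ) =
        ‖Q - u‖ ^ 2 / (2 * μ) + μ⁻¹ * ⟪u - Q, h⟫ + 1 / (2 * μ) * ‖h‖ ^ 2 := by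
        field_simp
      linarith
  exact hO.trans_isLittleO (Asymptotics.isLittleO_norm_pow_id one_lt_two)

lemma sc_first_order [CompleteSpace E] {f : E → ℝ} {m : ℝ} (hd : Differentiable ℝ f)
    (hsc : ConvexOn ℝ univ (fun x => f x - m / 2 * ‖x‖ ^ 2)) (y z : E) :
    f y + ⟪gradient f y, z - y⟫ + m / 2 * ‖z - y‖ ^ 2 ≤ f z := by
  have hline : HasDerivAt (fun s : ℝ => f (y + s • (z - y))) ⟪gradient f y, z - y⟫ 0 := by
    have h1 : HasFDerivAt f (innerSL ℝ (gradient f y)) (y + (0:ℝ) • (z - y)) := by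
      have := (hd y).hasGradientAt.hasFDerivAt
      rw [zero_smul, add_zero]; exact this
    have h2 : HasDerivAt (fun s : ℝ => y + s • (z - y)) (z - y) 0 := by
      simpa using ((hasDerivAt_id (0:ℝ)).smul_const (z - y)).const_add y
    exact h1.comp_hasDerivAt (0:ℝ) h2
  have hlim := hline.tendsto_slope_zero_right
  have hlim2 : Filter.Tendsto (fun s : ℝ => f z - f y - m / 2 * (1 - s) * ‖z - y‖ ^ 2)
      (nhdsWithin 0 (Ioi 0)) (nhds (f z - f y - m / 2 * (1 - 0) * ‖z - y‖ ^ 2)) := by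
    apply Filter.Tendsto.mono_left _ nhdsWithin_le_nhds
    apply Continuous.tendsto
    fun_prop
  have hle := le_of_tendsto_of_tendsto hlim hlim2 (by
    filter_upwards [Ioo_mem_nhdsGT (zero_lt_one' ℝ)] with s hs
    obtain ⟨hs0, hs1⟩ := hs
    have h2 := hsc.2 (mem_univ y) (mem_univ z) (by linarith : (0:ℝ) ≤ 1 - s) hs0.le (by ring)
    have e1 : (1 - s) • y + s • z = y + s • (z - y) := by module
    rw [e1] at h2
    simp only [smul_eq_mul] at h2
    have e2 : ‖y + s • (z - y)‖ ^ 2 = (1 - s) * ‖y‖ ^ 2 + s * ‖z‖ ^ 2 - s * (1 - s) * ‖z - y‖ ^ 2 := by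
      rw [← e1, norm_add_sq_real, norm_sub_sq_real, norm_smul, norm_smul, real_inner_smul_left,
        real_inner_smul_right, real_inner_comm, mul_pow, mul_pow, Real.norm_eq_abs, sq_abs,
        Real.norm_eq_abs, sq_abs]
      ring
    rw [e2] at h2
    simp only [zero_add, zero_smul, add_zero, smul_eq_mul]
    rw [inv_mul_le_iff₀ hs0]
    nlinarith)
  linarith

lemma norm_line_sq (y z : E) (s : ℝ) : ‖(1 - s) • y + s • z‖ ^ 2
    = (1 - s) * ‖y‖ ^ 2 + s * ‖z‖ ^ 2 - s * (1 - s) * ‖z - y‖ ^ 2 := by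
  rw [norm_add_sq_real, norm_sub_sq_real, norm_smul, norm_smul, real_inner_smul_left,
    real_inner_smul_right, real_inner_comm, mul_pow, mul_pow, Real.norm_eq_abs, sq_abs,
    Real.norm_eq_abs, sq_abs]
  ring

lemma quad_growth {f g F : E → ℝ} {m : ℝ}
    (hsc : ConvexOn ℝ univ (fun x => f x - m / 2 * ‖x‖ ^ 2)) (hg : ConvexOn ℝ univ g)
    (hF : ∀ x, F x = f x + g x) {xs : E} (hxs : IsMinOn F univ xs) (z : E) :
    F xs + m / 2 * ‖z - xs‖ ^ 2 ≤ F z := by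
  refine aux_limit (c := m / 2 * ‖z - xs‖ ^ 2) ?_
  intro s hs0 hs1
  have h0 := hxs (mem_univ ((1 - s) • xs + s • z))
  simp only [mem_ofPred_eq] at h0
  have h1 := hsc.2 (mem_univ xs) (mem_univ z) (by linarith : (0:ℝ) ≤ 1 - s) hs0.le (by ring)
  have h2 := hg.2 (mem_univ xs) (mem_univ z) (by linarith : (0:ℝ) ≤ 1 - s) hs0.le (by ring)
  simp only [smul_eq_mul] at h1 h2
  rw [norm_line_sq] at h1
  rw [hF, hF] at h0
  rw [hF, hF]
  have h3 : s * (f xs + g xs + m / 2 * ‖z - xs‖ ^ 2)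
      ≤ s * (f z + g z + s * (m / 2 * ‖z - xs‖ ^ 2)) := by nlinarith
  exact le_of_mul_le_mul_left h3 hs0

/-- forward-backward envelope -/
def fbe [CompleteSpace E] (f g : E → ℝ) (p : E → E) (μ : ℝ) (y : E) : ℝ :=
  f y - μ / 2 * ‖gradient f y‖ ^ 2 + (g (p (y - μ • gradient f y))
    + ‖p (y - μ • gradient f y) - (y - μ • gradient f y)‖ ^ 2 / (2 * μ))

lemma fbe_eq [CompleteSpace E] {f g : E → ℝ} {p : E → E} {μ : ℝ} (hμ : 0 < μ) {y G : E}
    (hG : G = μ⁻¹ • (y - p (y - μ • gradient f y))) :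
    p (y - μ • gradient f y) = y - μ • G ∧
    fbe f g p μ y = f y + g (y - μ • G) + μ / 2 * ‖G‖ ^ 2 - μ * ⟪gradient f y, G⟫ := by
  have h1 : p (y - μ • gradient f y) = y - μ • G := by
    rw [hG, smul_smul, mul_inv_cancel₀ hμ.ne', one_smul]; abel
  refine ⟨h1, ?_⟩
  unfold fbe
  rw [h1]
  have : y - μ • G - (y - μ • gradient f y) = μ • (gradient f y - G) := by module
  rw [this, norm_smul, mul_pow, norm_sub_sq_real, Real.norm_eq_abs, sq_abs]
  field_simp
  ring

lemma fbe_upper [CompleteSpace E] {f g F : E → ℝ} {m μ : ℝ} {p : E → E}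
    (hd : Differentiable ℝ f)
    (hsc : ConvexOn ℝ univ (fun x => f x - m / 2 * ‖x‖ ^ 2)) (hg : ConvexOn ℝ univ g)
    (hF : ∀ x, F x = f x + g x) (hμ : 0 < μ)
    (hp : ∀ u, IsMinOn (fun z => g z + ‖z - u‖ ^ 2 / (2 * μ)) univ (p u)) {y G : E}
    (hG : G = μ⁻¹ • (y - p (y - μ • gradient f y))) (z : E) :
    fbe f g p μ y - F z ≤ ⟪G, y - z⟫ - μ / 2 * ‖G‖ ^ 2 - m / 2 * ‖y - z‖ ^ 2 := by
  obtain ⟨h1, h2⟩ := fbe_eq (g := g) hμ hG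
  have h3 := prox_subgrad hg hμ (hp (y - μ • gradient f y)) z
  rw [h1] at h3
  have h4 := sc_first_order hd hsc y z
  have e1 : y - μ • gradient f y - (y - μ • G) = μ • (G - gradient f y) := by module
  have e2 : z - (y - μ • G) = μ • G - (y - z) := by module
  rw [e1, e2, real_inner_smul_left, ← mul_assoc, inv_mul_cancel₀ hμ.ne', one_mul] at h3
  simp only [inner_sub_left, inner_sub_right, real_inner_smul_right,
    real_inner_self_eq_norm_sq] at h3 h4 ⊢
  rw [hF, h2, norm_sub_rev y z]
  nlinarith

lemma fbe_lower [CompleteSpace E] {f g F : E → ℝ} {m L μ : ℝ} {p : E → E}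
    (hd : Differentiable ℝ f) (hm : 0 < m) (hmL : m ≤ L) (hμL : μ * L ≤ 1 / 4)
    (hsc : ConvexOn ℝ univ (fun x => f x - m / 2 * ‖x‖ ^ 2)) (hg : ConvexOn ℝ univ g)
    (hLip : ∀ x y, ‖gradient f x - gradient f y‖ ≤ L * ‖x - y‖)
    (hF : ∀ x, F x = f x + g x) (hμ : 0 < μ)
    {xs : E} (hxs : IsMinOn F univ xs) {y G : E}
    (hG : G = μ⁻¹ • (y - p (y - μ • gradient f y))) :
    m / 3 * ‖y - xs‖ ^ 2 ≤ fbe f g p μ y - F xs := by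
  obtain ⟨h1, h2⟩ := fbe_eq (g := g) hμ hG
  have h3 := quad_growth hsc hg hF hxs (y - μ • G)
  have h4 := sc_first_order hd hsc (y - μ • G) y
  have e1 : y - (y - μ • G) = μ • G := by module
  have e2 : y - μ • G - xs = (y - xs) - μ • G := by module
  have h5 := hLip (y - μ • G) y
  have e3 : y - μ • G - y = - (μ • G) := by module
  have h6 := real_inner_le_norm (gradient f y - gradient f (y - μ • G)) G
  rw [norm_sub_rev] at h6
  rw [e3, norm_neg, norm_smul, Real.norm_eq_abs, abs_of_pos hμ] at h5
  have h7 : ⟪gradient f y - gradient f (y - μ • G), G⟫ ≤ 1 / 4 * ‖G‖ ^ 2 := by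
    have : ‖gradient f (y - μ • G) - gradient f y‖ * ‖G‖ ≤ (L * (μ * ‖G‖)) * ‖G‖ :=
      mul_le_mul_of_nonneg_right h5 (norm_nonneg _)
    nlinarith [sq_nonneg ‖G‖]
  rw [e1, real_inner_smul_right] at h4
  rw [inner_sub_left] at h7
  rw [e2, norm_sub_sq_real, real_inner_smul_right, norm_smul, Real.norm_eq_abs, mul_pow, sq_abs,
    hF (y - μ • G)] at h3
  have h8 := real_inner_le_norm (y - xs) G
  have h9 : 0 ≤ m / 2 * ‖μ • G‖ ^ 2 := by positivity
  rw [h2]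
  have h10 : μ * (⟪gradient f y, G⟫ - ⟪gradient f (y - μ • G), G⟫) ≤ μ * (1 / 4 * ‖G‖ ^ 2) :=
    mul_le_mul_of_nonneg_left h7 hμ.le
  have h11 : m * μ * ⟪y - xs, G⟫ ≤ m * μ * (‖y - xs‖ * ‖G‖) :=
    mul_le_mul_of_nonneg_left h8 (by positivity)
  have hmμ : μ * m ≤ 1 / 4 := le_trans (mul_le_mul_of_nonneg_left hmL hμ.le) hμL
  have h12 : m * μ * (‖y - xs‖ * ‖G‖) ≤
      m / 6 * ‖y - xs‖ ^ 2 + (m * μ ^ 2 / 2 + μ / 4) * ‖G‖ ^ 2 := by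
    have a1 : 0 ≤ m / 6 * (‖y - xs‖ - 3 * μ * ‖G‖) ^ 2 := by positivity
    have a2 : 0 ≤ μ * (1 / 4 - μ * m) * ‖G‖ ^ 2 :=
      mul_nonneg (mul_nonneg hμ.le (by linarith)) (sq_nonneg _)
    nlinarith
  nlinarith

end helpers

lemma params {q γ β ρ : ℝ} (hq0 : 0 < q) (hq1 : q < 1) (hγ : γ = 2 * q / (q + 1))
    (hβ : β = 1 - γ) (hρ : ρ = q - q ^ 2 / 2) :
    0 < γ ∧ 0 < β ∧ 0 < ρ ∧
    (γ * (1 - β * γ) ^ 2 / 12 ≤ (1 - β * γ + ρ * β) * γ - ρ - ρ * (1 - β * γ + ρ * β) / 2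
      + ρ * q ^ 2 * β ^ 2 / 2) ∧
    (ρ * γ - ρ ^ 2 + ρ * q ^ 2 * β ≤ q ^ 2) ∧
    (0 < (1 - β * γ + ρ * β) + 2 / 3 * q ^ 2 * β ^ 2) ∧
    (0 < (ρ * γ - ρ ^ 2 + ρ * q ^ 2 * β + 2 / 3 * q ^ 2) *
      ((1 - β * γ + ρ * β) + 2 / 3 * q ^ 2 * β ^ 2) - (ρ + 2 / 3 * q ^ 2 * β) ^ 2) := by
  obtain ⟨u, hu, hqu⟩ : ∃ u : ℝ, 0 < u ∧ q = 1 / (1 + u) := by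
    refine ⟨1 / q - 1, ?_, ?_⟩
    · rw [sub_pos, lt_div_iff₀ hq0]; linarith
    · field_simp; ring
  have hγ' : γ = 2 / (2 + u) := by rw [hγ, hqu]; field_simp; ring
  have hβ' : β = u / (2 + u) := by rw [hβ, hγ']; field_simp; ring
  have hρ' : ρ = (1 + 2 * u) / (2 * (1 + u) ^ 2) := by rw [hρ, hqu]; field_simp; ring
  clear hγ hβ hρ
  subst hqu hγ' hβ' hρ'
  refine ⟨by positivity, by positivity, by positivity, ?_, ?_, ?_, ?_⟩
  · rw [← sub_nonneg]
    have : ((1 - u / (2 + u) * (2 / (2 + u)) + (1 + 2 * u) / (2 * (1 + u) ^ 2) * (u / (2 + u))) * (2 / (2 + u)) - (1 + 2 * u) / (2 * (1 + u) ^ 2) - (1 + 2 * u) / (2 * (1 + u) ^ 2) * (1 - u / (2 + u) * (2 / (2 + u)) + (1 + 2 * u) / (2 * (1 + u) ^ 2) * (u / (2 + u))) / 2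
      + (1 + 2 * u) / (2 * (1 + u) ^ 2) * (1 / (1 + u)) ^ 2 * (u / (2 + u)) ^ 2 / 2)
      - (2 / (2 + u)) * (1 - (u / (2 + u)) * (2 / (2 + u))) ^ 2 / 12
      = (16/3 + 50/3*u + 70/3*u^2 + 71/3*u^3 + 61/3*u^4 + 337/24*u^5 + 22/3*u^6 + 29/12*u^7 + 1/3*u^8)
        / ((1+u)^4 * (2+u)^5) := by
      field_simp
      ring
    rw [this]; positivity
  · rw [← sub_nonneg]
    have : (1 / (1 + u)) ^ 2 - ((1 + 2 * u) / (2 * (1 + u) ^ 2) * (2 / (2 + u)) - ((1 + 2 * u) / (2 * (1 + u) ^ 2)) ^ 2 + (1 + 2 * u) / (2 * (1 + u) ^ 2) * (1 / (1 + u)) ^ 2 * (u / (2 + u)))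
      = (3/2 + 11/4*u + u^2) / ((1+u)^4 * (2+u)) := by
      field_simp
      ring
    rw [this]; positivity
  · have : (1 - u / (2 + u) * (2 / (2 + u)) + (1 + 2 * u) / (2 * (1 + u) ^ 2) * (u / (2 + u))) + 2 / 3 * (1 / (1 + u)) ^ 2 * (u / (2 + u)) ^ 2
      = (4 + 11*u + 73/6*u^2 + 5*u^3 + u^4) / ((1+u)^2 * (2+u)^2) := by
      field_simp
      ring
    rw [this]; positivity
  · have : ((1 + 2 * u) / (2 * (1 + u) ^ 2) * (2 / (2 + u)) - ((1 + 2 * u) / (2 * (1 + u) ^ 2)) ^ 2 + (1 + 2 * u) / (2 * (1 + u) ^ 2) * (1 / (1 + u)) ^ 2 * (u / (2 + u)) + 2 / 3 * (1 / (1 + u)) ^ 2) * ((1 - u / (2 + u) * (2 / (2 + u)) + (1 + 2 * u) / (2 * (1 + u) ^ 2) * (u / (2 + u))) + 2 / 3 * (1 / (1 + u)) ^ 2 * (u / (2 + u)) ^ 2) - ((1 + 2 * u) / (2 * (1 + u) ^ 2) + 2 / 3 * (1 / (1 + u)) ^ 2 * (u / (2 + u))) ^ 2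
      = (16/3 + 149/6*u + 140/3*u^2 + 1127/24*u^3 + 347/12*u^4 + 71/6*u^5 + 11/3*u^6 + 2/3*u^7)
         / ((1+u)^6 * (2+u)^3) := by
      field_simp
      ring
    rw [this]; positivity

set_option maxHeartbeats 1000000 in
lemma dissip {q γ β ρ α m μ L C A S ee ev vv Ge Gv GG hGv hGG nG nv Φ : ℝ}
    (hα : 0 < α) (hμ : 0 < μ) (hρ : 0 < ρ) (hβ : 0 < β) (hγ : 0 < γ) (hL : 0 < L)
    (hq : α * m = q ^ 2) (hγβ : β = 1 - γ)
    (hμL : (μ * L) ^ 2 ≤ γ * β / 4) (hμL' : μ * L ≤ 1 / 4)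
    (hC : C = 1 - β * γ + ρ * β) (hA : A = ρ * γ - ρ ^ 2 + ρ * q ^ 2 * β)
    (hS : S = C * γ - ρ - ρ * C / 2 + ρ * q ^ 2 * β ^ 2 / 2)
    (hSb : γ * (1 - β * γ) ^ 2 / 12 ≤ S) (hAq : A ≤ q ^ 2)
    (hee : 0 ≤ ee) (hvv : vv = nv ^ 2) (hGGn : GG = nG ^ 2) (hnv : 0 ≤ nv) (hnG : 0 ≤ nG)
    (h1 : |hGv| ≤ L * nG * nv) (h2 : hGG ≤ L * nG ^ 2)
    (hΦ : Φ ≤ Ge + β * Gv - m / 2 * (ee + 2 * β * ev + β ^ 2 * vv)) :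
    α * ((1 - β * γ) * Gv - α * β * GG - μ * ((1 - β * γ) * hGv - α * β * hGG))
      + (A * ev + ρ * vv + ρ * (-γ * ev - α * Ge) + C * (-γ * vv - α * Gv))
      + ρ * (α * Φ + (A * ee + 2 * ρ * ev + C * vv) / 2) ≤ 0 := by
  have k0 : 0 < 1 - β * γ := by nlinarith
  set k := 1 - β * γ with hk
  have s1 : ρ * (α * Φ) ≤ ρ * α * (Ge + β * Gv) - ρ * q ^ 2 / 2 * (ee + 2 * β * ev + β ^ 2 * vv) := by
    have := mul_le_mul_of_nonneg_left hΦ (by positivity : 0 ≤ ρ * α)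
    rw [← hq]
    linarith
  have s2 : -(α * μ * k * hGv) ≤ α * k * ((μ * L) * nG * nv) := by
    have := mul_le_mul_of_nonneg_left (le_trans (neg_le_abs hGv) h1) (by positivity : 0 ≤ α * μ * k)
    linarith
  have s3 : α * (α * β * (μ * hGG)) ≤ α ^ 2 * β * (1 / 4 * nG ^ 2) := by
    have a1 := mul_le_mul_of_nonneg_left h2 (by positivity : 0 ≤ α ^ 2 * β * μ)
    have a2 := mul_le_mul_of_nonneg_left hμL' (by positivity : 0 ≤ α ^ 2 * β * nG ^ 2)
    linarith
  have s4 : α * k * ((μ * L) * nG * nv) ≤ 3 / 4 * β * (α * nG) ^ 2 + γ * k ^ 2 / 12 * nv ^ 2 := by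
    set s := μ * L
    have b1 : 0 ≤ 3 / 4 * β * (α * nG - 2 / (3 * β) * s * k * nv) ^ 2 := by positivity
    have b2 : 3 / 4 * β * (α * nG - 2 / (3 * β) * s * k * nv) ^ 2
       = 3 / 4 * β * (α * nG) ^ 2 - α * k * (s * nG * nv) + s ^ 2 * k ^ 2 * nv ^ 2 / (3 * β) := by
      field_simp; ring
    have b3 : s ^ 2 * k ^ 2 * nv ^ 2 / (3 * β) ≤ γ * k ^ 2 / 12 * nv ^ 2 := by
      rw [div_le_iff₀ (by positivity)]
      have := mul_le_mul_of_nonneg_right hμL (by positivity : 0 ≤ k ^ 2 * nv ^ 2)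
      linarith
    linarith
  have s5 : γ * k ^ 2 / 12 * nv ^ 2 ≤ S * nv ^ 2 := mul_le_mul_of_nonneg_right hSb (sq_nonneg _)
  have s6 : ρ * (A * ee) ≤ ρ * (q ^ 2 * ee) :=
    mul_le_mul_of_nonneg_left (mul_le_mul_of_nonneg_right hAq hee) hρ.le
  have key : α * (k * Gv - α * β * GG - μ * (k * hGv - α * β * hGG))
      + (A * ev + ρ * vv + ρ * (-γ * ev - α * Ge) + C * (-γ * vv - α * Gv))
      + (ρ * α * (Ge + β * Gv) - ρ * q ^ 2 / 2 * (ee + 2 * β * ev + β ^ 2 * vv)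
        + ρ * (A * ee + 2 * ρ * ev + C * vv) / 2)
      = -(α * μ * k * hGv) + α * (α * β * (μ * hGG)) - α ^ 2 * β * nG ^ 2 - S * nv ^ 2
        + (ρ * (A * ee) - ρ * (q ^ 2 * ee)) / 2 := by
    rw [hS, hGGn, hvv, hA, hC]; ring
  linarith

section dyn

variable {E : Type*} [NormedAddCommGroup E] [InnerProductSpace ℝ E] [CompleteSpace E]

lemma gradient_differentiable {f : E → ℝ} (hf : ContDiff ℝ 2 f) : Differentiable ℝ (gradient f) := by
  have h1 : Differentiable ℝ (fderiv ℝ f) :=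
    (hf.fderiv_right (m := 1) (by norm_num)).differentiable (by norm_num)
  have : gradient f = fun x => (InnerProductSpace.toDual ℝ E).symm.toContinuousLinearEquiv (fderiv ℝ f x) := by
    ext1 x; rfl
  rw [this]
  exact fun x => (InnerProductSpace.toDual ℝ E).symm.toContinuousLinearEquiv.differentiableAt.comp x (h1 x)

lemma fbe_deriv {f g : E → ℝ} (hf : ContDiff ℝ 2 f) (hg : ConvexOn ℝ univ g) {μ : ℝ} (hμ : 0 < μ)
    {p : E → E} (hp : ∀ u, IsMinOn (fun z => g z + ‖z - u‖ ^ 2 / (2 * μ)) univ (p u))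
    {y : ℝ → E} {y' : E} {s : Set ℝ} {t : ℝ} (hy : HasDerivWithinAt y y' s t) {G : E}
    (hG : G = μ⁻¹ • (y t - p (y t - μ • gradient f (y t)))) :
    HasDerivWithinAt (fun r => fbe f g p μ (y r))
      (⟪G, y'⟫ - μ * ⟪G, fderiv ℝ (gradient f) (y t) y'⟫) s t := by
  have hd : Differentiable ℝ f := hf.differentiable (by norm_num)
  have h1 : HasDerivWithinAt (fun r => f (y r)) ⟪gradient f (y t), y'⟫ s t := by
    have : HasFDerivAt f (innerSL ℝ (gradient f (y t))) (y t) := (hd (y t)).hasGradientAt.hasFDerivAt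
    exact this.comp_hasDerivWithinAt t hy
  set w' := fderiv ℝ (gradient f) (y t) y' with hw'
  have h2 : HasDerivWithinAt (fun r => gradient f (y r)) w' s t :=
    ((gradient_differentiable hf) (y t)).hasFDerivAt.comp_hasDerivWithinAt t hy
  have h3 := h2.norm_sq
  have h4 : HasDerivWithinAt (fun r => y r - μ • gradient f (y r)) (y' - μ • w') s t :=
    hy.sub (h2.const_smul μ)
  have h5 := (moreau_deriv hg hμ hp (y t - μ • gradient f (y t))).comp_hasDerivWithinAt t h4
  have h6 := (h1.sub (h3.const_mul (μ / 2))).add h5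
  refine h6.congr_deriv ?_
  have e : μ⁻¹ • (y t - μ • gradient f (y t) - p (y t - μ • gradient f (y t))) = G - gradient f (y t) := by
    rw [hG, smul_sub, smul_sub, smul_sub, smul_smul, inv_mul_cancel₀ hμ.ne', one_smul]; abel
  rw [e, innerSL_apply_apply]
  simp only [inner_sub_left, inner_sub_right, real_inner_smul_right]
  ring

lemma exp_decay {V V' : ℝ → ℝ} {ρ : ℝ} (hV : ∀ t ∈ Ici (0:ℝ), HasDerivWithinAt V (V' t) (Ici 0) t)
    (h : ∀ t ∈ Ici (0:ℝ), V' t + ρ * V t ≤ 0) (t : ℝ) (ht : 0 ≤ t) :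
    V t ≤ V 0 * Real.exp (-ρ * t) := by
  have hW : ∀ t ∈ Ici (0:ℝ), HasDerivWithinAt (fun t => V t * Real.exp (ρ * t))
      ((V' t + ρ * V t) * Real.exp (ρ * t)) (Ici 0) t := by
    intro t ht
    have h1 : HasDerivAt (fun t => Real.exp (ρ * t)) (Real.exp (ρ * t) * (ρ * 1)) t :=
      ((hasDerivAt_id t).const_mul ρ).exp
    refine ((hV t ht).mul h1.hasDerivWithinAt).congr_deriv ?_
    ring
  have hanti : AntitoneOn (fun t => V t * Real.exp (ρ * t)) (Ici 0) := by
    refine antitoneOn_of_hasDerivWithinAt_nonpos (f' := fun t => (V' t + ρ * V t) * Real.exp (ρ * t))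
      (convex_Ici 0) (fun t ht => (hW t ht).continuousWithinAt) ?_ ?_
    · intro t ht
      exact (hW t (interior_subset ht)).mono interior_subset
    · intro t ht
      exact mul_nonpos_of_nonpos_of_nonneg (h t (interior_subset ht)) (Real.exp_pos _).le
  have h0 := hanti (mem_Ici.2 le_rfl) (mem_Ici.2 ht) ht
  simp only [mul_zero, Real.exp_zero, mul_one] at h0
  rw [neg_mul, Real.exp_neg, ← div_eq_mul_inv, le_div_iff₀ (Real.exp_pos _)]
  exact h0

end dyn

set_option maxHeartbeats 1000000 in
/-- Theorem 3: accelerated exponential convergence of the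
accelerated forward–backward splitting dynamics for a general twice
continuously differentiable strongly convex `f` plus a convex lower
semicontinuous `g`. -/
theorem accelerated_FB_strongly_convex {n : ℕ}
    (f g F : EuclideanSpace ℝ (Fin n) → ℝ)
    (m L μ α γ β ρ : ℝ)
    (hm : 0 < m) (hL : 0 < L)
    (hfC2 : ContDiff ℝ 2 f)
    (hfsc : ConvexOn ℝ univ (fun x => f x - m / 2 * ‖x‖ ^ 2))
    (hfLip : ∀ x y, ‖gradient f x - gradient f y‖ ≤ L * ‖x - y‖)
    (hgconv : ConvexOn ℝ univ g) (hglsc : LowerSemicontinuous g)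
    (hF : ∀ x, F x = f x + g x)
    (hα : 0 < α) (hαm : α * m < 1)
    (hγ : γ = 2 * Real.sqrt (α * m) / (Real.sqrt (α * m) + 1))
    (hβ : β = 1 - γ)
    (hρ : ρ = Real.sqrt (α * m) - α * m / 2)
    (hμ : μ ∈ Ioc 0 (Real.sqrt (γ * β) / (2 * L)))
    (proxg : EuclideanSpace ℝ (Fin n) → EuclideanSpace ℝ (Fin n))
    (hproxg : ∀ v, IsMinOn (fun z => g z + ‖z - v‖ ^ 2 / (2 * μ)) univ (proxg v))
    (G : EuclideanSpace ℝ (Fin n) → EuclideanSpace ℝ (Fin n))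
    (hG : ∀ x, G x = μ⁻¹ • (x - proxg (x - μ • gradient f x))) :
    ∃ c > (0 : ℝ), ∀ x v a : ℝ → EuclideanSpace ℝ (Fin n),
      (∀ t ∈ Ici (0 : ℝ), HasDerivWithinAt x (v t) (Ici 0) t) →
      (∀ t ∈ Ici (0 : ℝ), HasDerivWithinAt v (a t) (Ici 0) t) →
      ContinuousOn a (Ici 0) →
      (∀ t ∈ Ici (0 : ℝ), a t + γ • v t + α • G (x t + β • v t) = 0) →
      ∀ xs, IsMinOn F univ xs →
        ∀ t ∈ Ici (0 : ℝ),
          ‖x t - xs‖ ^ 2 ≤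
            c * (‖x 0 - xs‖ ^ 2 + ‖v 0‖ ^ 2) * Real.exp (-ρ * t) := by
  have hd : Differentiable ℝ f := hfC2.differentiable (by norm_num)
  obtain ⟨hμ0, hμ1⟩ := hμ
  set q := Real.sqrt (α * m) with hqdef
  have hq2 : α * m = q ^ 2 := (Real.sq_sqrt (by positivity)).symm
  have hq0 : 0 < q := Real.sqrt_pos.2 (by positivity)
  have hq1 : q < 1 := by nlinarith
  have hρ' : ρ = q - q ^ 2 / 2 := by rw [hρ, hq2]
  obtain ⟨hγ0, hβ0, hρ0, hS, hAq, hC1, hdet⟩ := params hq0 hq1 hγ hβ hρ'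
  have hμL2 : (μ * L) ^ 2 ≤ γ * β / 4 := by
    have h1 : μ * L ≤ Real.sqrt (γ * β) / 2 := by
      rw [le_div_iff₀ (by positivity)] at hμ1
      linarith
    have h2 := pow_le_pow_left₀ (by positivity : 0 ≤ μ * L) h1 2
    rw [div_pow, Real.sq_sqrt (by positivity)] at h2
    linarith
  have hμL : μ * L ≤ 1 / 4 := by
    have : γ * β ≤ 1 / 4 := by rw [hβ]; nlinarith [sq_nonneg (γ - 1 / 2)]
    nlinarith [mul_pos hμ0 hL]
  rcases subsingleton_or_nontrivial (EuclideanSpace ℝ (Fin n)) with hsub | hnt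
  · refine ⟨1, one_pos, fun x v a _ _ _ _ xs _ t _ => ?_⟩
    rw [Subsingleton.elim (x t - xs) 0, norm_zero, zero_pow two_ne_zero]
    have := Real.exp_pos (-ρ * t)
    positivity
  have hmL : m ≤ L := by
    obtain ⟨y, z, hyz⟩ := exists_pair_ne (EuclideanSpace ℝ (Fin n))
    have h1 := sc_first_order hd hfsc y z
    have h2 := sc_first_order hd hfsc z y
    have h3 := (real_inner_le_norm (gradient f z - gradient f y) (z - y)).trans
      (mul_le_mul_of_nonneg_right (hfLip z y) (norm_nonneg _))
    have h4 : 0 < ‖z - y‖ := norm_pos_iff.2 (sub_ne_zero.2 hyz.symm)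
    rw [← neg_sub z y, inner_neg_right, norm_neg] at h2
    rw [inner_sub_left] at h3
    have h5 : m * ‖z - y‖ ^ 2 ≤ L * ‖z - y‖ ^ 2 := by nlinarith
    exact le_of_mul_le_mul_right h5 (by positivity)
  set C := 1 - β * γ + ρ * β with hC
  set A := ρ * γ - ρ ^ 2 + ρ * q ^ 2 * β with hA
  set C1 := C + 2 / 3 * q ^ 2 * β ^ 2 with hC1d
  set B1 := ρ + 2 / 3 * q ^ 2 * β with hB1d
  set A1 := A + 2 / 3 * q ^ 2 with hA1d
  set c1 := (A1 * C1 - B1 ^ 2) / (2 * C1) with hc1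
  have hc1p : 0 < c1 := by positivity
  set K := α / μ * (1 + β ^ 2) + |A| + ρ + |C| with hK
  have hKp : 0 < K := by positivity
  refine ⟨K / c1, by positivity, fun x v a hx hv _ hode xs hxs => ?_⟩
  have hGy : ∀ y, G y = μ⁻¹ • (y - proxg (y - μ • gradient f y)) := hG
  set y : ℝ → EuclideanSpace ℝ (Fin n) := fun t => x t + β • v t with hy
  set V : ℝ → ℝ := fun t => α * (fbe f g proxg μ (y t) - F xs)
    + (A * ‖x t - xs‖ ^ 2 + 2 * ρ * ⟪x t - xs, v t⟫ + C * ‖v t‖ ^ 2) / 2 with hV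
  have hnorm : ∀ t, ‖y t - xs‖ ^ 2 = ‖x t - xs‖ ^ 2 + 2 * β * ⟪x t - xs, v t⟫ + β ^ 2 * ‖v t‖ ^ 2 := by
    intro t
    have : y t - xs = (x t - xs) + β • v t := by simp only [hy]; abel
    rw [this, norm_add_sq_real, real_inner_smul_right, norm_smul, mul_pow, Real.norm_eq_abs, sq_abs]
    ring
  have hlow : ∀ t, c1 * ‖x t - xs‖ ^ 2 ≤ V t := by
    intro t
    have h1 := fbe_lower (p := proxg) hd hm hmL hμL hfsc hgconv hfLip hF hμ0 hxs (hGy (y t))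
    rw [hnorm] at h1
    have h2 := mul_le_mul_of_nonneg_left h1 hα.le
    have h3 : 0 ≤ ‖B1 • (x t - xs) + C1 • v t‖ ^ 2 := sq_nonneg _
    rw [norm_add_sq_real, real_inner_smul_right, real_inner_smul_left, norm_smul, norm_smul, mul_pow,
      mul_pow, Real.norm_eq_abs, sq_abs, Real.norm_eq_abs, sq_abs] at h3
    set ee := ‖x t - xs‖ ^ 2
    set ev := ⟪x t - xs, v t⟫
    set vv := ‖v t‖ ^ 2
    have h4 : (A1 * ee + 2 * B1 * ev + C1 * vv) / 2 ≤ V t := by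
      have e : α * (m / 3 * (ee + 2 * β * ev + β ^ 2 * vv)) = q ^ 2 / 3 * (ee + 2 * β * ev + β ^ 2 * vv) := by
        rw [← hq2]; ring
      rw [e] at h2
      simp only [hV, hA1d, hB1d, hC1d]
      linarith
    refine le_trans ?_ h4
    rw [hc1, div_mul_eq_mul_div, div_le_iff₀ (by positivity)]
    nlinarith
  have hup : V 0 ≤ K * (‖x 0 - xs‖ ^ 2 + ‖v 0‖ ^ 2) := by
    have h1 := fbe_upper hd hfsc hgconv hF hμ0 hproxg (hGy (y 0)) xs
    have h2 := hnorm 0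
    have h3 : fbe f g proxg μ (y 0) - F xs ≤ 1 / (2 * μ) * ‖y 0 - xs‖ ^ 2 := by
      have a1 := real_inner_le_norm (G (y 0)) (y 0 - xs)
      have a2 : 0 ≤ 1 / (2 * μ) * (‖y 0 - xs‖ - μ * ‖G (y 0)‖) ^ 2 := by positivity
      have a3 : 1 / (2 * μ) * (‖y 0 - xs‖ - μ * ‖G (y 0)‖) ^ 2 = 1 / (2 * μ) * ‖y 0 - xs‖ ^ 2
        - ‖G (y 0)‖ * ‖y 0 - xs‖ + μ / 2 * ‖G (y 0)‖ ^ 2 := by field_simp; ring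
      have a4 : 0 ≤ m / 2 * ‖y 0 - xs‖ ^ 2 := by positivity
      linarith
    have hev := real_inner_le_norm (x 0 - xs) (v 0)
    set e := ‖x 0 - xs‖
    set w := ‖v 0‖
    set ev := ⟪x 0 - xs, v 0⟫
    have hev2 : 2 * ev ≤ e ^ 2 + w ^ 2 := by nlinarith [sq_nonneg (e - w)]
    have h4 : ‖y 0 - xs‖ ^ 2 ≤ 2 * ((1 + β ^ 2) * (e ^ 2 + w ^ 2)) := by
      have : β * ev ≤ β * (e * w) := mul_le_mul_of_nonneg_left hev hβ0.le
      nlinarith [sq_nonneg (e - β * w), sq_nonneg (β * e), sq_nonneg w, sq_nonneg e, sq_nonneg (β * w)]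
    have h5 : α * (fbe f g proxg μ (y 0) - F xs) ≤ α / μ * (1 + β ^ 2) * (e ^ 2 + w ^ 2) := by
      have b1 := mul_le_mul_of_nonneg_left h3 hα.le
      have b2 := mul_le_mul_of_nonneg_left h4 (by positivity : 0 ≤ α * (1 / (2 * μ)))
      have b3 : α * (1 / (2 * μ)) * (2 * ((1 + β ^ 2) * (e ^ 2 + w ^ 2)))
        = α / μ * (1 + β ^ 2) * (e ^ 2 + w ^ 2) := by field_simp
      linarith
    have h6 : A * e ^ 2 ≤ |A| * e ^ 2 := mul_le_mul_of_nonneg_right (le_abs_self _) (sq_nonneg _)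
    have h7 : C * w ^ 2 ≤ |C| * w ^ 2 := mul_le_mul_of_nonneg_right (le_abs_self _) (sq_nonneg _)
    have h8 : 0 ≤ |A| * e ^ 2 := by positivity
    have h9 : 0 ≤ |C| * e ^ 2 := by positivity
    have h10 : 0 ≤ |A| * w ^ 2 := by positivity
    have h11 : 0 ≤ |C| * w ^ 2 := by positivity
    have h12 := mul_le_mul_of_nonneg_left hev2 hρ0.le
    have h13 : 0 ≤ ρ * (e ^ 2 + w ^ 2) := by positivity
    simp only [hV, hK]
    linarith
  have hacc : ∀ t ∈ Ici (0:ℝ), a t = -(γ • v t) - α • G (y t) := by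
    intro t ht
    have := hode t ht
    rw [← sub_eq_zero, ← this]; simp only [hy]; abel
  have hderiv : ∀ t ∈ Ici (0:ℝ), HasDerivWithinAt V
      (α * (⟪G (y t), v t + β • a t⟫ - μ * ⟪G (y t), fderiv ℝ (gradient f) (y t) (v t + β • a t)⟫)
       + (A * (2 * ⟪x t - xs, v t⟫) + 2 * ρ * (⟪x t - xs, a t⟫ + ⟪v t, v t⟫) + C * (2 * ⟪v t, a t⟫)) / 2)
       (Ici 0) t := by
    intro t ht
    have hyd : HasDerivWithinAt y (v t + β • a t) (Ici 0) t := (hx t ht).add ((hv t ht).const_smul β)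
    have h1 := fbe_deriv hfC2 hgconv hμ0 hproxg hyd (hGy (y t))
    have hxe : HasDerivWithinAt (fun t => x t - xs) (v t) (Ici 0) t := (hx t ht).sub_const xs
    have h2 := hxe.norm_sq
    have h3 := (hv t ht).norm_sq
    have h4 := hxe.inner ℝ (hv t ht)
    exact ((h1.sub_const (F xs)).const_mul α).add
      ((((h2.const_mul A).add (h4.const_mul (2 * ρ))).add (h3.const_mul C)).div_const 2)
  have hdis : ∀ t ∈ Ici (0:ℝ), 
      (α * (⟪G (y t), v t + β • a t⟫ - μ * ⟪G (y t), fderiv ℝ (gradient f) (y t) (v t + β • a t)⟫)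
       + (A * (2 * ⟪x t - xs, v t⟫) + 2 * ρ * (⟪x t - xs, a t⟫ + ⟪v t, v t⟫) + C * (2 * ⟪v t, a t⟫)) / 2)
       + ρ * V t ≤ 0 := by
    intro t ht
    have hop : ‖fderiv ℝ (gradient f) (y t)‖ ≤ L := by
      refine ((gradient_differentiable hfC2) (y t)).hasFDerivAt.le_of_lip' hL.le ?_
      exact Filter.Eventually.of_forall fun z => hfLip z (y t)
    set H := fderiv ℝ (gradient f) (y t) with hH
    set Γ := G (y t) with hΓ
    have hΦ := fbe_upper hd hfsc hgconv hF hμ0 hproxg (hGy (y t)) xs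
    rw [hnorm] at hΦ
    have ey : y t - xs = (x t - xs) + β • v t := by simp only [hy]; abel
    rw [ey, inner_add_right, real_inner_smul_right] at hΦ
    have hpos : 0 ≤ μ / 2 * ‖G (y t)‖ ^ 2 := by positivity
    have hHb : ∀ z, |⟪Γ, H z⟫| ≤ L * ‖Γ‖ * ‖z‖ := by
      intro z
      refine (abs_real_inner_le_norm _ _).trans ?_
      have : ‖H z‖ ≤ L * ‖z‖ := (H.le_opNorm z).trans (mul_le_mul_of_nonneg_right hop (norm_nonneg _))
      calc ‖Γ‖ * ‖H z‖ ≤ ‖Γ‖ * (L * ‖z‖) := mul_le_mul_of_nonneg_left this (norm_nonneg _)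
        _ = _ := by ring
    have hHG : ⟪Γ, H Γ⟫ ≤ L * ‖Γ‖ ^ 2 := by
      have := (le_abs_self _).trans (hHb Γ)
      linarith
    have hmain := dissip (ee := ‖x t - xs‖ ^ 2) (ev := ⟪x t - xs, v t⟫) (Ge := ⟪Γ, x t - xs⟫)
      (Gv := ⟪Γ, v t⟫) (Φ := fbe f g proxg μ (y t) - F xs)
      hα hμ0 hρ0 hβ0 hγ0 hL hq2 hβ hμL2 hμL hC hA rfl hS hAq
      (sq_nonneg _) rfl rfl (norm_nonneg (v t)) (norm_nonneg Γ) (hHb (v t)) hHG (by linarith)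
    have hva : v t + β • a t = (1 - β * γ) • v t - (α * β) • Γ := by
      rw [hacc t ht]; module
    rw [hva, hacc t ht, map_sub, map_smul, map_smul]
    simp only [inner_sub_right, inner_neg_right, real_inner_smul_right, real_inner_self_eq_norm_sq]
    rw [real_inner_comm Γ (x t - xs), real_inner_comm Γ (v t)]
    refine le_trans (le_of_eq ?_) hmain
    simp only [hV]
    ring
  intro t ht
  have hfin := exp_decay hderiv hdis t ht
  have h1 := (hlow t).trans (hfin.trans (mul_le_mul_of_nonneg_right hup (Real.exp_pos _).le))
  have : K / c1 * (‖x 0 - xs‖ ^ 2 + ‖v 0‖ ^ 2) * Real.exp (-ρ * t)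
     = (K * (‖x 0 - xs‖ ^ 2 + ‖v 0‖ ^ 2) * Real.exp (-ρ * t)) / c1 := by ring
  rw [this, le_div_iff₀ hc1p]
  linarith
end
end
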